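/- arXiv:0801.4753 — 5 statements merged into one kernel-verified Lean document; each statement's English description precedes it below -/
import Mathlib

section
/- Let n ≥ 3 be an integer and let x, y ∈ ℝⁿ with x ≠ y. Then the integral ∫_{ℝⁿ} |x − z|^{−2} |z − y|^{1−n} dH^n(z) converges and satisfies ((n−2) Γ((n−1)/2) / (2 π^{n/2} Γ(1/2))) · ∫_{ℝⁿ} |x − z|^{−2} |z − y|^{1−n} dH^n(z) = (π^{1/2} Γ(n/2) / Γ((n−1)/2)) · |x − y|^{−1}. -/
open MeasureTheory Metric Set ENNReal

section RieszComposition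

open Real

theorem lintegral_rpow_mul_exp_neg_mul_Ioi {a r : ℝ} (ha : 0 < a) (hr : 0 < r) :
    ∫⁻ t in Ioi (0:ℝ), ENNReal.ofReal (t ^ (a - 1) * exp (-(r * t))) =
      ENNReal.ofReal (r ^ (-a) * Gamma a) := by
  have key := integral_rpow_mul_exp_neg_mul_Ioi ha hr
  have hG := Gamma_pos_of_pos ha
  rw [← ofReal_integral_eq_lintegral_ofReal, key, one_div, inv_rpow hr.le, rpow_neg hr.le]
  · exact .of_integral_ne_zero (by rw [key]; positivity)
  · filter_upwards [ae_restrict_mem measurableSet_Ioi] with t ht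
    have : (0:ℝ) < t := ht
    positivity

theorem setLIntegral_Ioi_comp_mul_left {s : ℝ} (hs : 0 < s) (g : ℝ → ℝ≥0∞) :
    ∫⁻ t in Ioi (0:ℝ), g t = ∫⁻ v in Ioi (0:ℝ), ENNReal.ofReal s * g (s * v) := by
  have h := lintegral_image_eq_lintegral_abs_deriv_mul (s := Ioi (0:ℝ)) (f := fun v => s * v)
    (f' := fun _ => s) measurableSet_Ioi
    (fun v _ => by simpa using ((hasDerivAt_id v).const_mul s).hasDerivWithinAt)
    (mul_right_injective₀ hs.ne').injOn g
  rwa [image_mul_left_Ioi hs, mul_zero, abs_of_pos hs] at h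

theorem lintegral_rpow_mul_one_add_rpow_Ioi {p q : ℝ} (hp : 0 < p) (hq : 0 < q) :
    ∫⁻ v in Ioi (0:ℝ), ENNReal.ofReal (v ^ (p - 1) * (1 + v) ^ (-(p + q))) =
      ENNReal.ofReal (Gamma p * Gamma q / Gamma (p + q)) := by
  have hpq : 0 < p + q := by positivity
  have hG := Gamma_pos_of_pos hpq
  have hGp := Gamma_pos_of_pos hp
  have hGq := Gamma_pos_of_pos hq
  have hmul : ENNReal.ofReal (Gamma (p + q)) *
      ∫⁻ v in Ioi (0:ℝ), ENNReal.ofReal (v ^ (p - 1) * (1 + v) ^ (-(p + q))) =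
      ENNReal.ofReal (Gamma p * Gamma q) := by
    calc _ = ∫⁻ v in Ioi (0:ℝ), ∫⁻ r in Ioi (0:ℝ),
          ENNReal.ofReal (v ^ (p - 1) * (r ^ (p + q - 1) * exp (-((1 + v) * r)))) := by
          rw [← lintegral_const_mul' _ _ ofReal_ne_top]
          refine setLIntegral_congr_fun measurableSet_Ioi fun v hv => ?_
          have hv : (0:ℝ) < v := hv
          simp_rw [ENNReal.ofReal_mul (rpow_nonneg hv.le (p - 1))]
          rw [lintegral_const_mul' _ _ ofReal_ne_top,
            lintegral_rpow_mul_exp_neg_mul_Ioi hpq (by positivity),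
            ENNReal.ofReal_mul (by positivity)]
          ring
      _ = ∫⁻ r in Ioi (0:ℝ), ∫⁻ v in Ioi (0:ℝ),
          ENNReal.ofReal (v ^ (p - 1) * (r ^ (p + q - 1) * exp (-((1 + v) * r)))) :=
          lintegral_lintegral_swap (by fun_prop)
      _ = ∫⁻ r in Ioi (0:ℝ),
          ENNReal.ofReal (Gamma p) * ENNReal.ofReal (r ^ (q - 1) * exp (-(1 * r))) := by
          refine setLIntegral_congr_fun measurableSet_Ioi fun r hr => ?_
          have hr : (0:ℝ) < r := hr
          have h : ∀ v : ℝ, v ^ (p - 1) * (r ^ (p + q - 1) * exp (-((1 + v) * r))) =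
              (r ^ (p + q - 1) * exp (-r)) * (v ^ (p - 1) * exp (-(r * v))) := fun v => by
            rw [show -((1 + v) * r) = -r + -(r * v) by ring, exp_add]
            ring
          simp_rw [h, ENNReal.ofReal_mul (show 0 ≤ r ^ (p + q - 1) * exp (-r) by positivity)]
          rw [lintegral_const_mul' _ _ ofReal_ne_top, lintegral_rpow_mul_exp_neg_mul_Ioi hp hr,
            ← ENNReal.ofReal_mul (by positivity), ← ENNReal.ofReal_mul (by positivity),
            show p + q - 1 = p + (q - 1) by ring, rpow_add hr, rpow_neg hr.le, one_mul]
          congr 1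
          field_simp
      _ = _ := by
          rw [lintegral_const_mul' _ _ ofReal_ne_top,
            lintegral_rpow_mul_exp_neg_mul_Ioi hq one_pos, ← ENNReal.ofReal_mul (by positivity)]
          simp
  rw [ENNReal.ofReal_div_of_pos hG, ← hmul, mul_comm,
    ENNReal.mul_div_cancel_right (by simpa using hG) ofReal_ne_top]

variable {E : Type*} [NormedAddCommGroup E] [InnerProductSpace ℝ E] [FiniteDimensional ℝ E]
  [MeasurableSpace E] [BorelSpace E]

theorem lintegral_exp_neg_mul_sq_norm_sub_mul {s t : ℝ} (hs : 0 < s) (ht : 0 < t) (x y : E) :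
    ∫⁻ z : E, ENNReal.ofReal (exp (-(‖x - z‖ ^ 2 * t)) * exp (-(‖z - y‖ ^ 2 * s))) =
      ENNReal.ofReal ((π / (s + t)) ^ (Module.finrank ℝ E / 2 : ℝ) *
        exp (-(s * t / (s + t) * ‖x - y‖ ^ 2))) := by
  have hst : 0 < s + t := by positivity
  set m : E := (s + t)⁻¹ • (t • x + s • y) with hm
  have key := GaussianFourier.integral_rexp_neg_mul_sq_norm (V := E) hst
  have h : ∀ z : E, exp (-(‖x - z‖ ^ 2 * t)) * exp (-(‖z - y‖ ^ 2 * s)) =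
      exp (-(s * t / (s + t) * ‖x - y‖ ^ 2)) * exp (-(s + t) * ‖z - m‖ ^ 2) := fun z => by
    rw [← exp_add, ← exp_add]
    congr 1
    simp only [hm, ← real_inner_self_eq_norm_sq, inner_sub_left, inner_sub_right, inner_add_left,
      inner_add_right, real_inner_smul_left, real_inner_smul_right, real_inner_comm z x,
      real_inner_comm z y, real_inner_comm y x]
    field_simp
    ring
  simp_rw [h, ENNReal.ofReal_mul (exp_pos (-(s * t / (s + t) * ‖x - y‖ ^ 2))).le]
  rw [lintegral_const_mul' _ _ ofReal_ne_top,
    lintegral_sub_right_eq_self (fun z : E => ENNReal.ofReal (exp (-(s + t) * ‖z‖ ^ 2))) m,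
    ← ofReal_integral_eq_lintegral_ofReal, key, ← ENNReal.ofReal_mul (by positivity), mul_comm]
  · exact .of_integral_ne_zero (by rw [key]; positivity)
  · exact .of_forall fun z => (exp_pos _).le

/-- The scaling `t = s * v` of the heat-kernel parameters separates the two integrations. -/
theorem lintegral_lintegral_rpow_mul_exp_neg_div {a b d c : ℝ} (ha : a < d) (hb : b < d)
    (hab : d < a + b) (hc : 0 < c) :
    ∫⁻ s in Ioi (0:ℝ), ∫⁻ t in Ioi (0:ℝ), ENNReal.ofReal (t ^ (a - 1) * s ^ (b - 1) *
        ((π / (s + t)) ^ d * exp (-(s * t / (s + t) * c)))) =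
      ENNReal.ofReal (π ^ d * Gamma (a + b - d) *
        (Gamma (d - b) * Gamma (d - a) / Gamma (d - b + (d - a))) * c ^ (d - a - b)) := by
  have hG := Gamma_pos_of_pos (show 0 < a + b - d by linarith)
  have hGb := Gamma_pos_of_pos (show 0 < d - b by linarith)
  have hGa := Gamma_pos_of_pos (show 0 < d - a by linarith)
  have hGab := Gamma_pos_of_pos (show 0 < d - b + (d - a) by linarith)
  calc _ = ∫⁻ s in Ioi (0:ℝ), ∫⁻ v in Ioi (0:ℝ),
        ENNReal.ofReal (π ^ d * (v ^ (a - 1) * (1 + v) ^ (-d)) *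
          (s ^ (a + b - d - 1) * exp (-(v / (1 + v) * c * s)))) := by
        refine setLIntegral_congr_fun measurableSet_Ioi fun s hs => ?_
        have hs : (0:ℝ) < s := hs
        rw [setLIntegral_Ioi_comp_mul_left hs]
        refine setLIntegral_congr_fun measurableSet_Ioi fun v hv => ?_
        have hv : (0:ℝ) < v := hv
        rw [← ENNReal.ofReal_mul hs.le]
        congr 1
        rw [show s + s * v = s * (1 + v) by ring, mul_rpow hs.le hv.le,
          div_rpow pi_pos.le (by positivity), mul_rpow hs.le (by positivity),
          show a + b - d - 1 = 1 + (a - 1) + (b - 1) + -d by ring, rpow_add hs, rpow_add hs,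
          rpow_add hs, Real.rpow_one, rpow_neg hs.le, Real.rpow_neg (by positivity),
          show s * (s * v) / (s * (1 + v)) * c = v / (1 + v) * c * s by field_simp]
        field_simp
    _ = ∫⁻ v in Ioi (0:ℝ), ∫⁻ s in Ioi (0:ℝ),
        ENNReal.ofReal (π ^ d * (v ^ (a - 1) * (1 + v) ^ (-d)) *
          (s ^ (a + b - d - 1) * exp (-(v / (1 + v) * c * s)))) :=
        lintegral_lintegral_swap (by fun_prop)
    _ = ∫⁻ v in Ioi (0:ℝ), ENNReal.ofReal (π ^ d * Gamma (a + b - d) * c ^ (d - a - b)) *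
        ENNReal.ofReal (v ^ (d - b - 1) * (1 + v) ^ (-(d - b + (d - a)))) := by
        refine setLIntegral_congr_fun measurableSet_Ioi fun v hv => ?_
        have hv : (0:ℝ) < v := hv
        have hv1 : (0:ℝ) < 1 + v := by positivity
        simp_rw [ENNReal.ofReal_mul
          (show 0 ≤ π ^ d * (v ^ (a - 1) * (1 + v) ^ (-d)) by positivity)]
        rw [lintegral_const_mul' _ _ ofReal_ne_top,
          lintegral_rpow_mul_exp_neg_mul_Ioi (by linarith) (by positivity),
          ← ENNReal.ofReal_mul (by positivity), ← ENNReal.ofReal_mul (by positivity)]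
        congr 1
        rw [show -(a + b - d) = d - a - b by ring, mul_rpow (by positivity) hc.le,
          div_rpow hv.le hv1.le, show d - b - 1 = (a - 1) + (d - a - b) by ring,
          show -(d - b + (d - a)) = -d + -(d - a - b) by ring, rpow_add hv, rpow_add hv1,
          rpow_neg hv1.le (d - a - b)]
        field_simp
    _ = _ := by
        rw [lintegral_const_mul' _ _ ofReal_ne_top,
          lintegral_rpow_mul_one_add_rpow_Ioi (by linarith) (by linarith),
          ← ENNReal.ofReal_mul (by positivity)]
        congr 1
        ring

/-- Composition of two Riesz kernels on a Euclidean space of dimension `2 * d`. -/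
theorem lintegral_norm_rpow_mul_norm_rpow {a b d : ℝ} (hd : d = Module.finrank ℝ E / 2)
    (ha : 0 < a) (had : a < d) (hb : 0 < b) (hbd : b < d) (hab : d < a + b)
    {x y : E} (hxy : x ≠ y) :
    ∫⁻ z : E, ENNReal.ofReal (‖x - z‖ ^ (-(2 * a)) * ‖z - y‖ ^ (-(2 * b))) =
      ENNReal.ofReal (π ^ d * Gamma (a + b - d) *
        (Gamma (d - b) * Gamma (d - a) / Gamma (d - b + (d - a))) / (Gamma a * Gamma b) *
          ‖x - y‖ ^ (2 * (d - a - b))) := by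
  have hGa := Gamma_pos_of_pos ha
  have hGb := Gamma_pos_of_pos hb
  have hR : 0 < ‖x - y‖ := norm_pos_iff.2 (sub_ne_zero.2 hxy)
  have : Nontrivial E := ⟨x, y, hxy⟩
  have hmul : ENNReal.ofReal (Gamma a * Gamma b) *
      ∫⁻ z : E, ENNReal.ofReal (‖x - z‖ ^ (-(2 * a)) * ‖z - y‖ ^ (-(2 * b))) =
      ENNReal.ofReal (π ^ d * Gamma (a + b - d) *
        (Gamma (d - b) * Gamma (d - a) / Gamma (d - b + (d - a))) *
          (‖x - y‖ ^ 2) ^ (d - a - b)) := by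
    rw [← lintegral_lintegral_rpow_mul_exp_neg_div had hbd hab (by positivity)]
    calc _ = ∫⁻ z : E, ∫⁻ s in Ioi (0:ℝ), ∫⁻ t in Ioi (0:ℝ),
          ENNReal.ofReal (s ^ (b - 1) * exp (-(‖z - y‖ ^ 2 * s))) *
            ENNReal.ofReal (t ^ (a - 1) * exp (-(‖x - z‖ ^ 2 * t))) := by
          rw [← lintegral_const_mul' _ _ ofReal_ne_top]
          refine lintegral_congr_ae ?_
          filter_upwards [Measure.ae_ne volume x, Measure.ae_ne volume y] with z hzx hzy
          have hx : 0 < ‖x - z‖ := norm_pos_iff.2 (sub_ne_zero.2 hzx.symm)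
          have hy : 0 < ‖z - y‖ := norm_pos_iff.2 (sub_ne_zero.2 hzy)
          simp_rw [lintegral_const_mul' _ _ ofReal_ne_top]
          rw [lintegral_mul_const' _ _ (by
              rw [lintegral_rpow_mul_exp_neg_mul_Ioi ha (by positivity)]; exact ofReal_ne_top),
            lintegral_rpow_mul_exp_neg_mul_Ioi ha (by positivity),
            lintegral_rpow_mul_exp_neg_mul_Ioi hb (by positivity),
            ← ENNReal.ofReal_mul (by positivity), ← ENNReal.ofReal_mul (by positivity),
            ← rpow_natCast_mul hx.le, ← rpow_natCast_mul hy.le]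
          congr 1
          push_cast
          rw [mul_neg, mul_neg]
          ring
      _ = ∫⁻ s in Ioi (0:ℝ), ∫⁻ z : E, ∫⁻ t in Ioi (0:ℝ),
          ENNReal.ofReal (s ^ (b - 1) * exp (-(‖z - y‖ ^ 2 * s))) *
            ENNReal.ofReal (t ^ (a - 1) * exp (-(‖x - z‖ ^ 2 * t))) := by
          refine lintegral_lintegral_swap (Measurable.aemeasurable ?_)
          exact Measurable.lintegral_prod_right' (f := fun p : (E × ℝ) × ℝ =>
            ENNReal.ofReal (p.1.2 ^ (b - 1) * exp (-(‖p.1.1 - y‖ ^ 2 * p.1.2))) *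
            ENNReal.ofReal (p.2 ^ (a - 1) * exp (-(‖x - p.1.1‖ ^ 2 * p.2)))) (by fun_prop)
      _ = ∫⁻ s in Ioi (0:ℝ), ∫⁻ t in Ioi (0:ℝ), ∫⁻ z : E,
          ENNReal.ofReal (s ^ (b - 1) * exp (-(‖z - y‖ ^ 2 * s))) *
            ENNReal.ofReal (t ^ (a - 1) * exp (-(‖x - z‖ ^ 2 * t))) :=
          lintegral_congr fun s => lintegral_lintegral_swap (by fun_prop)
      _ = _ := by
          refine setLIntegral_congr_fun measurableSet_Ioi fun s hs => ?_
          refine setLIntegral_congr_fun measurableSet_Ioi fun t ht => ?_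
          have hs : (0:ℝ) < s := hs
          have ht : (0:ℝ) < t := ht
          have h : ∀ z : E, ENNReal.ofReal (s ^ (b - 1) * exp (-(‖z - y‖ ^ 2 * s))) *
              ENNReal.ofReal (t ^ (a - 1) * exp (-(‖x - z‖ ^ 2 * t))) =
              ENNReal.ofReal (t ^ (a - 1) * s ^ (b - 1)) * ENNReal.ofReal
                (exp (-(‖x - z‖ ^ 2 * t)) * exp (-(‖z - y‖ ^ 2 * s))) := fun z => by
            rw [← ENNReal.ofReal_mul (by positivity), ← ENNReal.ofReal_mul (by positivity)]
            congr 1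
            ring
          simp_rw [h]
          rw [lintegral_const_mul' _ _ ofReal_ne_top,
            lintegral_exp_neg_mul_sq_norm_sub_mul hs ht, ← ENNReal.ofReal_mul (by positivity), hd]
  have hG : 0 < Gamma a * Gamma b := by positivity
  rw [← rpow_natCast_mul hR.le] at hmul
  rw [div_mul_eq_mul_div, ENNReal.ofReal_div_of_pos hG]
  push_cast at hmul
  rw [← hmul, mul_comm (ENNReal.ofReal _),
    ENNReal.mul_div_cancel_right (by simpa using hG) ofReal_ne_top]

end RieszComposition

/-- For `n ≥ 3` and `x ≠ y` in `ℝⁿ`, the integral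
`∫ |x - z|⁻² |z - y|^{1-n} dH^n(z)` converges and
`((n-2) Γ((n-1)/2) / (2 π^{n/2} Γ(1/2))) ∫ |x - z|⁻² |z - y|^{1-n} dz
  = (π^{1/2} Γ(n/2) / Γ((n-1)/2)) |x - y|⁻¹`. -/
theorem stmt_1 (n : ℕ) (hn : 3 ≤ n) (x y : EuclideanSpace ℝ (Fin n)) (hxy : x ≠ y) :
    Integrable (fun z : EuclideanSpace ℝ (Fin n) =>
        ‖x - z‖ ^ (-(2:ℝ)) * ‖z - y‖ ^ ((1:ℝ) - n)) volume ∧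
    (((n:ℝ) - 2) * Real.Gamma (((n:ℝ) - 1)/2) /
          (2 * Real.pi ^ ((n:ℝ)/2) * Real.Gamma (1/2))) *
        ∫ z : EuclideanSpace ℝ (Fin n), ‖x - z‖ ^ (-(2:ℝ)) * ‖z - y‖ ^ ((1:ℝ) - n) =
      (Real.pi ^ ((1:ℝ)/2) * Real.Gamma ((n:ℝ)/2) / Real.Gamma (((n:ℝ) - 1)/2)) *
        ‖x - y‖⁻¹ := by
  have hn' : (3:ℝ) ≤ n := by exact_mod_cast hn
  have hR : 0 < ‖x - y‖ := norm_pos_iff.2 (sub_ne_zero.2 hxy)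
  have key := lintegral_norm_rpow_mul_norm_rpow (a := 1) (b := ((n:ℝ) - 1) / 2) (d := (n:ℝ) / 2)
    (by simp) one_pos (by linarith) (by linarith) (by linarith) (by linarith) hxy
  rw [show (1:ℝ) + (n - 1) / 2 - n / 2 = 1 / 2 by ring,
    show (n:ℝ) / 2 - (n - 1) / 2 = 1 / 2 by ring,
    show (1:ℝ) / 2 + (n / 2 - 1) = (n - 1) / 2 by ring,
    show 2 * ((n:ℝ) / 2 - 1 - (n - 1) / 2) = -1 by ring,
    show -(2 * (((n:ℝ) - 1) / 2)) = 1 - n by ring, mul_one, Real.Gamma_one, one_mul,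
    Real.rpow_neg_one] at key
  have hG1 := Real.Gamma_pos_of_pos (show 0 < ((n:ℝ) - 1) / 2 by linarith)
  have hG2 := Real.Gamma_pos_of_pos (show 0 < (n:ℝ) / 2 - 1 by linarith)
  have hG3 := Real.Gamma_pos_of_pos (show (0:ℝ) < 1 / 2 by norm_num)
  have hnonneg : ∀ z : EuclideanSpace ℝ (Fin n),
      0 ≤ ‖x - z‖ ^ (-(2:ℝ)) * ‖z - y‖ ^ ((1:ℝ) - n) := fun z => by positivity
  have hmeas : AEStronglyMeasurable (fun z : EuclideanSpace ℝ (Fin n) =>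
      ‖x - z‖ ^ (-(2:ℝ)) * ‖z - y‖ ^ ((1:ℝ) - n)) volume :=
    Measurable.aestronglyMeasurable (by fun_prop)
  refine ⟨(lintegral_ofReal_ne_top_iff_integrable hmeas (.of_forall hnonneg)).1
    (key ▸ ofReal_ne_top), ?_⟩
  rw [integral_eq_lintegral_of_nonneg_ae (.of_forall hnonneg) hmeas, key,
    ENNReal.toReal_ofReal (by positivity)]
  have hstep : Real.Gamma ((n:ℝ) / 2) = ((n:ℝ) / 2 - 1) * Real.Gamma ((n:ℝ) / 2 - 1) := by
    rw [← Real.Gamma_add_one (by linarith), sub_add_cancel]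
  rw [hstep, ← Real.sqrt_eq_rpow, ← Real.Gamma_one_half_eq]
  field_simp
end

section
/- Let α ≥ 1 be a real number and let φ : [0,∞) → [0,∞) be nonincreasing and Lebesgue integrable. Then α · ∫₀^∞ t^{α−1} φ(t)^α dt ≤ (∫₀^∞ φ(t) dt)^α. -/
open MeasureTheory Set ENNReal

/-- A nonincreasing function on `[0, ∞)` is at most its average over `[0, t]`. -/
lemma mul_le_integral_of_antitoneOn {φ : ℝ → ℝ} (hmono : AntitoneOn φ (Ici 0))
    (hint : IntegrableOn φ (Ici 0)) {t : ℝ} (ht : 0 ≤ t) :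
    t * φ t ≤ ∫ s in (0:ℝ)..t, φ s := by
  have hφ : IntervalIntegrable φ volume 0 t :=
    (intervalIntegrable_iff_integrableOn_Ioc_of_le ht).2
      (hint.mono_set fun _ hs => hs.1.le)
  calc t * φ t = ∫ _ in (0:ℝ)..t, φ t := by simp
    _ ≤ ∫ s in (0:ℝ)..t, φ s :=
      intervalIntegral.integral_mono_on ht intervalIntegrable_const hφ
        fun s hs => hmono hs.1 ht hs.2

/-- The chain rule and the fundamental theorem of calculus for `(∫₀^t φ) ^ α`. -/
lemma integral_rpow_primitive_of_antitoneOn {α : ℝ} (hα : 1 ≤ α) {φ : ℝ → ℝ}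
    (hmono : AntitoneOn φ (Ici 0)) (hint : IntegrableOn φ (Ici 0)) {T : ℝ} (hT : 0 ≤ T) :
    IntervalIntegrable (fun t => φ t * α * (∫ s in (0:ℝ)..t, φ s) ^ (α - 1)) volume 0 T ∧
      ∫ t in (0:ℝ)..T, φ t * α * (∫ s in (0:ℝ)..t, φ s) ^ (α - 1) =
        (∫ s in (0:ℝ)..T, φ s) ^ α := by
  have hφ : ∀ {t : ℝ}, 0 ≤ t → IntervalIntegrable φ volume 0 t := fun ht =>
    (intervalIntegrable_iff_integrableOn_Ioc_of_le ht).2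
      (hint.mono_set fun _ hs => hs.1.le)
  have hF : ContinuousOn (fun t => ∫ s in (0:ℝ)..t, φ s) (Icc 0 T) :=
    intervalIntegral.continuousOn_primitive_interval'
      (hφ hT) left_mem_uIcc |>.mono (uIcc_of_le hT).ge
  have hint' : IntervalIntegrable (fun t => φ t * α * (∫ s in (0:ℝ)..t, φ s) ^ (α - 1))
      volume 0 T := by
    refine ((hφ hT).mul_const α).mul_continuousOn ?_
    rw [uIcc_of_le hT]
    exact hF.rpow_const fun _ _ => Or.inr (by linarith)
  refine ⟨hint', ?_⟩
  have key := integral_eq_of_hasDerivAt_off_countable_of_le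
    (fun t => (∫ s in (0:ℝ)..t, φ s) ^ α) _ hT hmono.countable_not_continuousWithinAt
    (hF.rpow_const fun _ _ => Or.inr (by linarith)) (fun t ht => ?_) hint'
  · rw [key, intervalIntegral.integral_same, Real.zero_rpow (by linarith), sub_zero]
  · have hnhds : Ici (0:ℝ) ∈ nhds t := Ici_mem_nhds ht.1.1
    have hcont : ContinuousAt φ t := by
      by_contra h
      exact ht.2 ⟨ht.1.1.le, fun hc => h (hc.continuousAt hnhds)⟩
    exact (intervalIntegral.integral_hasDerivAt_right (hφ ht.1.1.le)
      ⟨_, hnhds, hint.aestronglyMeasurable⟩ hcont).rpow_const (Or.inr hα)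

/-- The inequality on a bounded interval. -/
lemma ofReal_mul_setLIntegral_Ioc_le {α : ℝ} (hα : 1 ≤ α) {φ : ℝ → ℝ}
    (hnonneg : ∀ t ∈ Ici (0:ℝ), 0 ≤ φ t) (hmono : AntitoneOn φ (Ici 0))
    (hint : IntegrableOn φ (Ici 0)) {T : ℝ} (hT : 0 ≤ T) :
    ENNReal.ofReal α * ∫⁻ t in Ioc 0 T, ENNReal.ofReal (t ^ (α - 1) * φ t ^ α) ≤
      (∫⁻ t in Ioc 0 T, ENNReal.ofReal (φ t)) ^ α := by
  have hα0 : 0 ≤ α := by linarith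
  obtain ⟨hI, hEq⟩ := integral_rpow_primitive_of_antitoneOn hα hmono hint hT
  rw [intervalIntegrable_iff_integrableOn_Ioc_of_le hT] at hI
  rw [intervalIntegral.integral_of_le hT, intervalIntegral.integral_of_le hT] at hEq
  have hpos : ∀ t ∈ Ioc 0 T, 0 ≤ φ t := fun t ht => hnonneg t ht.1.le
  have hle : ∀ t ∈ Ioc 0 T, α * (t ^ (α - 1) * φ t ^ α) ≤
      φ t * α * (∫ s in (0:ℝ)..t, φ s) ^ (α - 1) := fun t ht => by
    have hp := hpos t ht
    have hsplit : φ t ^ α = φ t ^ (α - 1) * φ t := by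
      conv_rhs => rw [← Real.rpow_add_one' hp (by linarith), sub_add_cancel]
    calc α * (t ^ (α - 1) * φ t ^ α) = φ t * α * (t * φ t) ^ (α - 1) := by
          rw [Real.mul_rpow ht.1.le hp, hsplit]; ring
      _ ≤ _ := by
          gcongr
          · exact mul_nonneg ht.1.le hp
          · exact mul_le_integral_of_antitoneOn hmono hint ht.1.le
  rw [← lintegral_const_mul' _ _ ofReal_ne_top]
  calc ∫⁻ t in Ioc 0 T, ENNReal.ofReal α * ENNReal.ofReal (t ^ (α - 1) * φ t ^ α)
      ≤ ∫⁻ t in Ioc 0 T,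
          ENNReal.ofReal (φ t * α * (∫ s in (0:ℝ)..t, φ s) ^ (α - 1)) := by
        refine setLIntegral_mono' measurableSet_Ioc fun t ht => ?_
        rw [← ENNReal.ofReal_mul hα0]
        exact ENNReal.ofReal_le_ofReal (hle t ht)
    _ = ENNReal.ofReal ((∫ t in Ioc 0 T, φ t) ^ α) := by
        rw [← hEq, ofReal_integral_eq_lintegral_ofReal hI]
        filter_upwards [ae_restrict_mem measurableSet_Ioc] with t ht
        have hp := hpos t ht
        have h0 : 0 ≤ α * (t ^ (α - 1) * φ t ^ α) := by
          have := ht.1.le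
          positivity
        exact h0.trans (hle t ht)
    _ = (∫⁻ t in Ioc 0 T, ENNReal.ofReal (φ t)) ^ α := by
        rw [← ENNReal.ofReal_rpow_of_nonneg (setIntegral_nonneg measurableSet_Ioc hpos) hα0,
          ofReal_integral_eq_lintegral_ofReal (hint.mono_set fun _ hs => hs.1.le)]
        exact (ae_restrict_mem measurableSet_Ioc).mono hpos

/-- If `α ≥ 1` and `φ : [0,∞) → [0,∞)` is nonincreasing and Lebesgue integrable,
then `α ∫₀^∞ t^{α-1} φ(t)^α dt ≤ (∫₀^∞ φ(t) dt)^α`. -/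
theorem stmt_3 (α : ℝ) (hα : 1 ≤ α) (φ : ℝ → ℝ)
    (hnonneg : ∀ t ∈ Ici (0:ℝ), 0 ≤ φ t)
    (hmono : AntitoneOn φ (Ici 0))
    (hint : IntegrableOn φ (Ici 0)) :
    ENNReal.ofReal α * ∫⁻ t in Ioi (0:ℝ), ENNReal.ofReal (t ^ (α - 1) * φ t ^ α) ≤
      (∫⁻ t in Ioi (0:ℝ), ENNReal.ofReal (φ t)) ^ α := by
  have hunion : Ioi (0:ℝ) = ⋃ n : ℕ, Ioc (0:ℝ) n :=
    (iUnion_Ioc_eq_Ioi_self_iff.2 fun x _ => exists_nat_ge x).symm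
  have hdir : Directed (· ⊆ ·) fun n : ℕ => Ioc (0:ℝ) n :=
    Monotone.directed_le fun m n hmn => Ioc_subset_Ioc_right (by exact_mod_cast hmn)
  conv_lhs => rw [hunion, setLIntegral_iUnion_of_directed _ hdir, ENNReal.mul_iSup]
  refine iSup_le fun n => ?_
  refine (ofReal_mul_setLIntegral_Ioc_le hα hnonneg hmono hint n.cast_nonneg).trans ?_
  gcongr
  exact Ioc_subset_Ioi_self
end

section
/- Let κ > 0 and let 0 ≤ q < p < ∞ be real numbers. Suppose F : [0,∞) → [0,∞) is continuously differentiable, nonincreasing, and satisfies F'(t) + κ·F(t) ≤ 0 for all t ≥ 0 (equivalently, t ↦ e^{κt}F(t) is nonincreasing). Then ∫₀^∞ t^p (−F'(t)) dt ≤ κ^{q−p} · (Γ(p+1)/Γ(q+1)) · ∫₀^∞ t^q (−F'(t)) dt. Moreover, equality holds when F(t) = F(0)e^{−κt}. -/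
open MeasureTheory Set ENNReal

open Filter Topology

theorem nonpos_of_deriv_nonpos_of_deriv_nonneg {N d : ℝ → ℝ} {t₀ : ℝ} (ht₀ : 0 ≤ t₀)
    (hcont : Continuous N) (hderiv : ∀ t, 0 < t → HasDerivAt N (d t) t) (hN0 : N 0 ≤ 0)
    (hlim : Tendsto N atTop (𝓝 0)) (hneg : ∀ t, 0 < t → t < t₀ → d t ≤ 0)
    (hpos : ∀ t, t₀ < t → 0 ≤ d t) {t : ℝ} (ht : 0 ≤ t) : N t ≤ 0 := by
  rcases le_total t t₀ with h | h
  · have hanti : AntitoneOn N (Icc 0 t₀) := by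
      apply antitoneOn_of_deriv_nonpos (convex_Icc 0 t₀) hcont.continuousOn
      · intro x hx
        rw [interior_Icc] at hx
        exact (hderiv x hx.1).differentiableAt.differentiableWithinAt
      · intro x hx
        rw [interior_Icc] at hx
        rw [(hderiv x hx.1).deriv]
        exact hneg x hx.1 hx.2
    exact (hanti ⟨le_rfl, ht₀⟩ ⟨ht, h⟩ ht).trans hN0
  · have hmono : MonotoneOn N (Ici t₀) := by
      apply monotoneOn_of_deriv_nonneg (convex_Ici t₀) hcont.continuousOn
      · intro x hx
        rw [interior_Ici] at hx
        exact (hderiv x (ht₀.trans_lt hx)).differentiableAt.differentiableWithinAt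
      · intro x hx
        rw [interior_Ici] at hx
        rw [(hderiv x (ht₀.trans_lt hx)).deriv]
        exact hpos x hx
    refine ge_of_tendsto hlim ?_
    filter_upwards [eventually_ge_atTop t] with s hs
    exact hmono h (h.trans hs) hs

theorem integrableOn_rpow_mul_exp_neg_mul {a κ : ℝ} (ha : 0 ≤ a) (hκ : 0 < κ) :
    IntegrableOn (fun t : ℝ => t ^ a * Real.exp (-κ * t)) (Ioi 0) := by
  simpa using integrableOn_rpow_mul_exp_neg_mul_rpow (p := 1) (s := a) (b := κ)
    (by linarith) one_pos hκ

theorem integral_rpow_mul_exp_neg_mul {a κ : ℝ} (ha : 0 ≤ a) (hκ : 0 < κ) :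
    ∫ t in Ioi (0 : ℝ), t ^ a * Real.exp (-κ * t) = Real.Gamma (a + 1) / κ ^ (a + 1) := by
  have h := Real.integral_rpow_mul_exp_neg_mul_Ioi (a := a + 1) (r := κ) (by linarith) hκ
  simp only [add_sub_cancel_right] at h
  simp only [neg_mul]
  rw [h, Real.div_rpow zero_le_one hκ.le, Real.one_rpow]
  ring

theorem gamma_const_mul {κ : ℝ} (p : ℝ) {q : ℝ} (hκ : 0 < κ) (hq : 0 ≤ q) :
    κ ^ (q - p) * (Real.Gamma (p + 1) / Real.Gamma (q + 1)) *
      (Real.Gamma (q + 1) / κ ^ (q + 1)) = Real.Gamma (p + 1) / κ ^ (p + 1) := by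
  have hΓ := (Real.Gamma_pos_of_pos (show 0 < q + 1 by linarith)).ne'
  have h1 : κ ^ (q + 1) = κ ^ (q - p) * κ ^ (p + 1) := by
    rw [← Real.rpow_add hκ]
    ring_nf
  have h2 := (Real.rpow_pos_of_pos hκ (q - p)).ne'
  have h3 := (Real.rpow_pos_of_pos hκ (p + 1)).ne'
  rw [h1]
  field_simp

/-- The incomplete Laplace integral of `t ^ p - C * t ^ q` is controlled by the integrand when the
complete integral vanishes. -/
theorem rpow_sub_mul_exp_add_integral_nonpos {κ p q C : ℝ} (hκ : 0 < κ) (hq : 0 ≤ q) (hqp : q < p)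
    (hC : 0 ≤ C) (hCΓ : C * (Real.Gamma (q + 1) / κ ^ (q + 1)) = Real.Gamma (p + 1) / κ ^ (p + 1))
    {t : ℝ} (ht : 0 ≤ t) :
    (t ^ p - C * t ^ q) * Real.exp (-κ * t) +
      κ * ∫ s in (0 : ℝ)..t, (s ^ p - C * s ^ q) * Real.exp (-κ * s) ≤ 0 := by
  have hp : 0 < p := hq.trans_lt hqp
  set g : ℝ → ℝ := fun s => (s ^ p - C * s ^ q) * Real.exp (-κ * s) with hg
  have hgc : Continuous g := by
    have := Real.continuous_rpow_const hp.le
    have := Real.continuous_rpow_const hq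
    fun_prop
  have hgeq : g = fun s => s ^ p * Real.exp (-κ * s) - C * (s ^ q * Real.exp (-κ * s)) := by
    funext s
    simp only [hg]
    ring
  have hKd : ∀ t, HasDerivAt (fun u => ∫ s in (0 : ℝ)..u, g s) (g t) t := fun t =>
    (hgc.integral_hasStrictDerivAt 0 t).hasDerivAt
  have hip := integrableOn_rpow_mul_exp_neg_mul hp.le hκ
  have hiq := (integrableOn_rpow_mul_exp_neg_mul hq hκ).const_mul C
  have hzero : ∫ s in Ioi (0 : ℝ), g s = 0 := by
    rw [hgeq, integral_sub hip hiq, integral_const_mul, integral_rpow_mul_exp_neg_mul hp.le hκ,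
      integral_rpow_mul_exp_neg_mul hq hκ, hCΓ, sub_self]
  have hKlim : Tendsto (fun u => ∫ s in (0 : ℝ)..u, g s) atTop (𝓝 0) := by
    have hgi : IntegrableOn g (Ioi 0) := by
      rw [hgeq]
      exact hip.sub hiq
    simpa only [hzero, id] using intervalIntegral_tendsto_integral_Ioi 0 hgi tendsto_id
  have hglim : Tendsto g atTop (𝓝 0) := by
    rw [hgeq]
    simpa using (tendsto_rpow_mul_exp_neg_mul_atTop_nhds_zero p κ hκ).sub
      ((tendsto_rpow_mul_exp_neg_mul_atTop_nhds_zero q κ hκ).const_mul C)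
  have hpq : 0 < p - q := sub_pos.2 hqp
  have hr : 0 ≤ C * q / p := by positivity
  have hfac : ∀ t : ℝ, 0 < t → p * t ^ (p - 1) - C * (q * t ^ (q - 1)) =
      p * t ^ (q - 1) * (t ^ (p - q) - C * q / p) := by
    intro t ht
    have : t ^ (p - 1) = t ^ (q - 1) * t ^ (p - q) := by
      rw [← Real.rpow_add ht]
      ring_nf
    rw [this]
    field_simp
  have ht₀ : ((C * q / p) ^ (p - q)⁻¹) ^ (p - q) = C * q / p :=
    Real.rpow_inv_rpow hr hpq.ne'
  refine nonpos_of_deriv_nonpos_of_deriv_nonneg (N := fun t => g t + κ * ∫ s in (0 : ℝ)..t, g s)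
    (d := fun t => (p * t ^ (p - 1) - C * (q * t ^ (q - 1))) * Real.exp (-κ * t))
    (t₀ := (C * q / p) ^ (p - q)⁻¹) (Real.rpow_nonneg hr _) ?_ ?_ ?_ ?_ ?_ ?_ ht
  · exact hgc.add (continuous_const.mul
      (continuous_iff_continuousAt.2 fun t => (hKd t).continuousAt))
  · intro t ht
    have hexp : HasDerivAt (fun s => Real.exp (-κ * s)) (Real.exp (-κ * t) * (-κ)) t := by
      simpa using ((hasDerivAt_id t).const_mul (-κ)).exp
    have h := ((((Real.hasDerivAt_rpow_const (p := p) (Or.inl ht.ne')).sub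
      ((Real.hasDerivAt_rpow_const (p := q) (Or.inl ht.ne')).const_mul C)).mul hexp).add
        ((hKd t).const_mul κ))
    refine h.congr_deriv ?_
    simp only [hg, Pi.sub_apply]
    ring
  · simp only [hg, intervalIntegral.integral_same, Real.zero_rpow hp.ne']
    have : (0 : ℝ) ≤ C * 0 ^ q := mul_nonneg hC (Real.rpow_nonneg le_rfl _)
    simpa using this
  · simpa using hglim.add (hKlim.const_mul κ)
  · intro t ht htt
    rw [hfac t ht]
    have : t ^ (p - q) ≤ C * q / p := ht₀ ▸ Real.rpow_le_rpow ht.le htt.le hpq.le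
    exact mul_nonpos_of_nonpos_of_nonneg (mul_nonpos_of_nonneg_of_nonpos
      (mul_nonneg hp.le (Real.rpow_nonneg ht.le _)) (sub_nonpos.2 this)) (Real.exp_pos _).le
  · intro t htt
    have h0 := Real.rpow_nonneg hr (p - q)⁻¹
    have ht : 0 < t := h0.trans_lt htt
    rw [hfac t ht]
    have : C * q / p ≤ t ^ (p - q) := ht₀ ▸ Real.rpow_le_rpow h0 htt.le hpq.le
    exact mul_nonneg (mul_nonneg (mul_nonneg hp.le (Real.rpow_nonneg ht.le _))
      (sub_nonneg.2 this)) (Real.exp_pos _).le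

theorem integral_rpow_mul_neg_deriv_le {κ p q C : ℝ} (hκ : 0 < κ) (hq : 0 ≤ q) (hqp : q < p)
    (hC : 0 ≤ C) (hCΓ : C * (Real.Gamma (q + 1) / κ ^ (q + 1)) = Real.Gamma (p + 1) / κ ^ (p + 1))
    {F F' : ℝ → ℝ} (hF' : ∀ t ∈ Ici (0:ℝ), HasDerivAt F (F' t) t)
    (hF'cont : ContinuousOn F' (Ici 0)) (hFnonneg : ∀ t ∈ Ici (0:ℝ), 0 ≤ F t)
    (hode : ∀ t ∈ Ici (0:ℝ), F' t + κ * F t ≤ 0) {T : ℝ} (hT : 0 ≤ T) :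
    ∫ t in (0 : ℝ)..T, t ^ p * (-F' t) ≤ C * ∫ t in (0 : ℝ)..T, t ^ q * (-F' t) := by
  have hp : 0 < p := hq.trans_lt hqp
  have hpc := Real.continuous_rpow_const hp.le
  have hqc := Real.continuous_rpow_const hq
  set g : ℝ → ℝ := fun s => (s ^ p - C * s ^ q) * Real.exp (-κ * s) with hg
  have hgc : Continuous g := by fun_prop
  set K : ℝ → ℝ := fun u => ∫ s in (0 : ℝ)..u, g s with hK
  have hKd : ∀ t, HasDerivAt K (g t) t := fun t => (hgc.integral_hasStrictDerivAt 0 t).hasDerivAt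
  have hKc : Continuous K := continuous_iff_continuousAt.2 fun t => (hKd t).continuousAt
  have hN : ∀ t, 0 ≤ t → g t + κ * K t ≤ 0 := fun t ht =>
    rpow_sub_mul_exp_add_integral_nonpos hκ hq hqp hC hCΓ ht
  have hEd : ∀ t, HasDerivAt (fun u => Real.exp (κ * u) * K u)
      (Real.exp (κ * t) * (g t + κ * K t)) t := by
    intro t
    have hexp : HasDerivAt (fun s => Real.exp (κ * s)) (Real.exp (κ * t) * κ) t := by
      simpa using ((hasDerivAt_id t).const_mul κ).exp
    exact (hexp.mul (hKd t)).congr_deriv (by ring)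
  have hEanti : AntitoneOn (fun u => Real.exp (κ * u) * K u) (Ici 0) := by
    apply antitoneOn_of_deriv_nonpos (convex_Ici 0)
    · exact (by fun_prop : Continuous (fun u => Real.exp (κ * u) * K u)).continuousOn
    · exact fun x _ => (hEd x).differentiableAt.differentiableWithinAt
    · intro x hx
      rw [interior_Ici] at hx
      rw [(hEd x).deriv]
      exact mul_nonpos_of_nonneg_of_nonpos (Real.exp_pos _).le (hN x (le_of_lt hx))
  have hE : Real.exp (κ * T) * K T ≤ 0 := by
    have h := hEanti (mem_Ici.2 le_rfl) (mem_Ici.2 hT) hT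
    simpa [hK] using h
  have hsub : uIcc 0 T ⊆ Ici (0 : ℝ) := by
    rw [uIcc_of_le hT]
    exact fun x hx => hx.1
  have hF'c : ContinuousOn F' (uIcc 0 T) := hF'cont.mono hsub
  have hFc : ContinuousOn F (uIcc 0 T) := fun t ht =>
    (hF' t (hsub ht)).continuousAt.continuousWithinAt
  set D : ℝ → ℝ := fun t => κ * (Real.exp (κ * t) * (g t + κ * K t) * F t +
    Real.exp (κ * t) * K t * F' t) with hD
  have hDi : IntervalIntegrable D volume 0 T := by
    apply ContinuousOn.intervalIntegrable
    have h1 : ContinuousOn (fun t => Real.exp (κ * t) * (g t + κ * K t)) (uIcc 0 T) := by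
      fun_prop
    have h2 : ContinuousOn (fun t => Real.exp (κ * t) * K t) (uIcc 0 T) := by fun_prop
    exact continuousOn_const.mul ((h1.mul hFc).add (h2.mul hF'c))
  have hDint : ∫ t in (0 : ℝ)..T, D t = κ * (Real.exp (κ * T) * K T * F T) := by
    rw [intervalIntegral.integral_eq_sub_of_hasDerivAt
      (f := fun t => κ * (Real.exp (κ * t) * K t * F t)) (fun t ht =>
        ((hEd t).mul (hF' t (hsub ht))).const_mul κ) hDi]
    simp [hK]
  have hpi : IntervalIntegrable (fun t => t ^ p * (-F' t)) volume 0 T :=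
    (hpc.continuousOn.mul hF'c.neg).intervalIntegrable
  have hqi : IntervalIntegrable (fun t => C * (t ^ q * (-F' t))) volume 0 T :=
    (continuousOn_const.mul (hqc.continuousOn.mul hF'c.neg)).intervalIntegrable
  rw [← sub_nonpos, ← intervalIntegral.integral_const_mul,
    ← intervalIntegral.integral_sub hpi hqi]
  have hle : ∫ t in (0 : ℝ)..T, (t ^ p * (-F' t) - C * (t ^ q * (-F' t))) ≤
      ∫ t in (0 : ℝ)..T, D t := by
    refine intervalIntegral.integral_mono_on hT (hpi.sub hqi) hDi fun t ht => ?_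
    have hee : Real.exp (κ * t) * Real.exp (-κ * t) = 1 := by
      rw [← Real.exp_add]
      simp
    have hid : D t - (t ^ p * (-F' t) - C * (t ^ q * (-F' t))) =
        Real.exp (κ * t) * ((g t + κ * K t) * (F' t + κ * F t)) := by
      simp only [hD, hg]
      linear_combination (-(t ^ p - C * t ^ q) * F' t) * hee
    have hnn : 0 ≤ Real.exp (κ * t) * ((g t + κ * K t) * (F' t + κ * F t)) :=
      mul_nonneg (Real.exp_pos _).le (mul_nonneg_of_nonpos_of_nonpos (hN t ht.1) (hode t ht.1))
    linarith
  refine hle.trans ?_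
  rw [hDint]
  exact mul_nonpos_of_nonneg_of_nonpos hκ.le
    (mul_nonpos_of_nonpos_of_nonneg hE (hFnonneg T hT))

theorem lintegral_rpow_mul_const_exp {a κ c : ℝ} (ha : 0 ≤ a) (hκ : 0 < κ) (hc : 0 ≤ c) :
    ∫⁻ t in Ioi (0 : ℝ), ENNReal.ofReal (t ^ a * (c * Real.exp (-κ * t))) =
      ENNReal.ofReal (c * (Real.Gamma (a + 1) / κ ^ (a + 1))) := by
  rw [← integral_rpow_mul_exp_neg_mul ha hκ, ← integral_const_mul,
    ofReal_integral_eq_lintegral_ofReal ((integrableOn_rpow_mul_exp_neg_mul ha hκ).const_mul c)]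
  · simp only [mul_left_comm]
  · filter_upwards [ae_restrict_mem measurableSet_Ioi] with t ht
    exact mul_nonneg hc (mul_nonneg (Real.rpow_nonneg (le_of_lt ht) _) (Real.exp_pos _).le)



/-- Let `κ > 0` and `0 ≤ q < p < ∞`. If `F : [0,∞) → [0,∞)` is continuously
differentiable, nonincreasing and satisfies `F'(t) + κ F(t) ≤ 0` for all `t ≥ 0`, then
`∫₀^∞ t^p (-F'(t)) dt ≤ κ^{q-p} (Γ(p+1)/Γ(q+1)) ∫₀^∞ t^q (-F'(t)) dt`;
moreover equality holds when `F(t) = F(0) e^{-κt}`. -/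
theorem stmt_5 (κ p q : ℝ) (hκ : 0 < κ) (hq : 0 ≤ q) (hqp : q < p)
    (F F' : ℝ → ℝ)
    (hF' : ∀ t ∈ Ici (0:ℝ), HasDerivAt F (F' t) t)
    (hF'cont : ContinuousOn F' (Ici 0))
    (hFnonneg : ∀ t ∈ Ici (0:ℝ), 0 ≤ F t)
    (hFmono : AntitoneOn F (Ici 0))
    (hode : ∀ t ∈ Ici (0:ℝ), F' t + κ * F t ≤ 0) :
    (∫⁻ t in Ioi (0:ℝ), ENNReal.ofReal (t ^ p * (-F' t)) ≤
        ENNReal.ofReal (κ ^ (q - p) * (Real.Gamma (p + 1) / Real.Gamma (q + 1))) *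
          ∫⁻ t in Ioi (0:ℝ), ENNReal.ofReal (t ^ q * (-F' t))) ∧
    ((∀ t ∈ Ici (0:ℝ), F t = F 0 * Real.exp (-κ * t)) →
      ∫⁻ t in Ioi (0:ℝ), ENNReal.ofReal (t ^ p * (-F' t)) =
        ENNReal.ofReal (κ ^ (q - p) * (Real.Gamma (p + 1) / Real.Gamma (q + 1))) *
          ∫⁻ t in Ioi (0:ℝ), ENNReal.ofReal (t ^ q * (-F' t))) := by
  set C := κ ^ (q - p) * (Real.Gamma (p + 1) / Real.Gamma (q + 1)) with hCdef
  have hp : 0 < p := hq.trans_lt hqp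
  have hC : 0 ≤ C := mul_nonneg (Real.rpow_nonneg hκ.le _)
    (div_nonneg (Real.Gamma_nonneg_of_nonneg (by linarith))
      (Real.Gamma_nonneg_of_nonneg (by linarith)))
  have hCΓ := gamma_const_mul p hκ hq
  rw [← hCdef] at hCΓ
  have hF'nonneg : ∀ t ∈ Ici (0:ℝ), 0 ≤ -F' t := fun t ht => by
    have := mul_nonneg hκ.le (hFnonneg t ht)
    linarith [hode t ht]
  constructor
  · have htrunc : ∀ a : ℝ, 0 ≤ a → ∀ n : ℕ,
        ∫⁻ t in Ioc (0:ℝ) n, ENNReal.ofReal (t ^ a * (-F' t)) =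
          ENNReal.ofReal (∫ t in (0:ℝ)..n, t ^ a * (-F' t)) := by
      intro a ha n
      have hn : (0:ℝ) ≤ n := n.cast_nonneg
      have hsub : uIcc (0:ℝ) n ⊆ Ici (0:ℝ) := by
        rw [uIcc_of_le hn]
        exact fun x hx => hx.1
      have hi : IntervalIntegrable (fun t => t ^ a * (-F' t)) volume 0 n :=
        ((Real.continuous_rpow_const ha).continuousOn.mul
          (hF'cont.mono hsub).neg).intervalIntegrable
      rw [intervalIntegral.integral_of_le hn, ofReal_integral_eq_lintegral_ofReal hi.1]
      filter_upwards [ae_restrict_mem measurableSet_Ioc] with t ht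
      exact mul_nonneg (Real.rpow_nonneg ht.1.le _) (hF'nonneg t ht.1.le)
    have hunion : Ioi (0:ℝ) = ⋃ n : ℕ, Ioc (0:ℝ) n := by
      ext x
      simp only [mem_Ioi, mem_iUnion, mem_Ioc, exists_and_left]
      exact ⟨fun h => ⟨h, exists_nat_ge x⟩, fun h => h.1⟩
    have hdir : Directed (· ⊆ ·) fun n : ℕ => Ioc (0:ℝ) n :=
      Monotone.directed_le fun m n hmn => Ioc_subset_Ioc_right (Nat.cast_le.2 hmn)
    conv_lhs => rw [hunion]
    rw [setLIntegral_iUnion_of_directed _ hdir]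
    refine iSup_le fun n => ?_
    calc ∫⁻ t in Ioc (0:ℝ) n, ENNReal.ofReal (t ^ p * (-F' t))
        = ENNReal.ofReal (∫ t in (0:ℝ)..n, t ^ p * (-F' t)) := htrunc p hp.le n
      _ ≤ ENNReal.ofReal (C * ∫ t in (0:ℝ)..n, t ^ q * (-F' t)) :=
          ENNReal.ofReal_le_ofReal (integral_rpow_mul_neg_deriv_le hκ hq hqp hC hCΓ hF' hF'cont
            hFnonneg hode n.cast_nonneg)
      _ = ENNReal.ofReal C * ∫⁻ t in Ioc (0:ℝ) n, ENNReal.ofReal (t ^ q * (-F' t)) := by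
          rw [ENNReal.ofReal_mul hC, htrunc q hq n]
      _ ≤ ENNReal.ofReal C * ∫⁻ t in Ioi (0:ℝ), ENNReal.ofReal (t ^ q * (-F' t)) := by
          gcongr
          exact fun x hx => hx.1
  · intro hF
    have hderiv : ∀ t ∈ Ioi (0:ℝ), -F' t = κ * F 0 * Real.exp (-κ * t) := by
      intro t ht
      have h1 : HasDerivAt (fun s => F 0 * Real.exp (-κ * s))
          (F 0 * (Real.exp (-κ * t) * (-κ))) t := by
        simpa using (((hasDerivAt_id t).const_mul (-κ)).exp).const_mul (F 0)
      have h2 : F =ᶠ[𝓝 t] fun s => F 0 * Real.exp (-κ * s) := by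
        filter_upwards [Ioi_mem_nhds ht] with s hs using hF s (Ioi_subset_Ici_self hs)
      rw [(hF' t (Ioi_subset_Ici_self ht)).unique (h1.congr_of_eventuallyEq h2)]
      ring
    have hc : 0 ≤ κ * F 0 := mul_nonneg hκ.le (hFnonneg 0 (mem_Ici.2 le_rfl))
    have hval : ∀ a : ℝ, 0 ≤ a → ∫⁻ t in Ioi (0:ℝ), ENNReal.ofReal (t ^ a * (-F' t)) =
        ENNReal.ofReal (κ * F 0 * (Real.Gamma (a + 1) / κ ^ (a + 1))) := by
      intro a ha
      rw [← lintegral_rpow_mul_const_exp ha hκ hc]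
      refine setLIntegral_congr_fun measurableSet_Ioi fun t ht => ?_
      simp only [hderiv t ht]
    rw [hval p hp.le, hval q hq, ← ENNReal.ofReal_mul hC, ← hCΓ]
    congr 1
    ring
end

section
/- Let κ > 0 and q ≥ 0 be real numbers. Suppose F : [0,∞) → [0,∞) is continuously differentiable, nonincreasing, and satisfies F'(t) + κ·F(t) ≤ 0 for all t ≥ 0. Define F_q(t) = ∫_t^∞ r^q (−F'(r)) dr. Then for every t ≥ 0, F_q(t) ≤ F_q(0) · (κ^{q+1}/Γ(q+1)) · ∫_t^∞ r^q e^{−κr} dr. -/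
open MeasureTheory Set ENNReal

open Filter Topology in
/-- A continuous function on `[a, ∞)`, nonnegative there, whose integrals over `[a, T]` are bounded
by a convergent function of `T` is integrable on `(a, ∞)`, with integral at most the limit. -/
lemma integrableOn_Ioi_and_integral_le_of_intervalIntegral_le {f B : ℝ → ℝ} {a L : ℝ}
    (hf : ContinuousOn f (Ici a)) (hf0 : ∀ r ∈ Ici a, 0 ≤ f r)
    (hB : Tendsto B atTop (𝓝 L)) (hle : ∀ T, a ≤ T → ∫ r in a..T, f r ≤ B T) :
    IntegrableOn f (Ioi a) ∧ ∫ r in Ioi a, f r ≤ L := by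
  have hint : IntegrableOn f (Ioi a) := by
    refine integrableOn_Ioi_of_intervalIntegral_norm_bounded (l := atTop) (b := id) (L + 1) a
      (fun T ↦ ?_) tendsto_id ?_
    · exact ((hf.mono Icc_subset_Ici_self).integrableOn_Icc).mono_set Ioc_subset_Icc_self
    · filter_upwards [eventually_ge_atTop a, hB.eventually_le_const (lt_add_one L)] with T hT hBT
      refine le_trans (le_of_eq ?_) ((hle T hT).trans hBT)
      refine intervalIntegral.integral_congr fun r hr ↦ ?_
      rw [id, uIcc_of_le hT] at hr
      exact Real.norm_of_nonneg (hf0 r hr.1)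
  refine ⟨hint, le_of_tendsto_of_tendsto
    (intervalIntegral_tendsto_integral_Ioi a hint tendsto_id) hB ?_⟩
  filter_upwards [eventually_ge_atTop a] with T hT using hle T hT

/-- Integration by parts against the weight `r ^ q` for a nonpositive function, dropping the
nonpositive term `q r ^ (q - 1) ψ r`. -/
lemma rpow_mul_sub_le_integral_rpow_mul_deriv {q a b : ℝ} {ψ ψ' : ℝ → ℝ} (hq : 0 ≤ q)
    (ha : 0 ≤ a) (hab : a ≤ b) (hψ : ∀ r ∈ Icc a b, HasDerivAt ψ (ψ' r) r)
    (hψ' : ContinuousOn ψ' (Icc a b)) (hψ0 : ∀ r ∈ Icc a b, ψ r ≤ 0) :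
    b ^ q * ψ b - a ^ q * ψ a ≤ ∫ r in a..b, r ^ q * ψ' r := by
  have hpow : Continuous fun r : ℝ ↦ r ^ q := Real.continuous_rpow_const hq
  refine intervalIntegral.sub_le_integral_of_hasDeriv_right_of_le (g := fun r ↦ r ^ q * ψ r)
    (g' := fun r ↦ q * r ^ (q - 1) * ψ r + r ^ q * ψ' r) hab ?_ (fun r hr ↦ ?_) ?_ (fun r hr ↦ ?_)
  · exact hpow.continuousOn.mul fun r hr ↦ (hψ r hr).continuousAt.continuousWithinAt
  · exact ((Real.hasDerivAt_rpow_const (Or.inl (ha.trans_lt hr.1).ne')).mul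
      (hψ r (Ioo_subset_Icc_self hr))).hasDerivWithinAt
  · exact (hpow.continuousOn.mul hψ').integrableOn_Icc
  · have h1 : 0 ≤ q * r ^ (q - 1) := mul_nonneg hq (Real.rpow_nonneg (ha.trans hr.1.le) _)
    have h2 := mul_nonpos_of_nonneg_of_nonpos h1 (hψ0 r (Ioo_subset_Icc_self hr))
    linarith

/-- If `F' + κ F ≤ 0` on `[0, ∞)` then `F r * exp (κ r)` is nonincreasing there. -/
lemma antitoneOn_mul_exp_of_deriv_add_mul_nonpos {κ : ℝ} {F F' : ℝ → ℝ}
    (hF' : ∀ t ∈ Ici (0 : ℝ), HasDerivAt F (F' t) t)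
    (hode : ∀ t ∈ Ici (0 : ℝ), F' t + κ * F t ≤ 0) :
    AntitoneOn (fun r ↦ F r * Real.exp (κ * r)) (Ici 0) := by
  have hd : ∀ r ∈ Ici (0 : ℝ), HasDerivAt (fun r ↦ F r * Real.exp (κ * r))
      ((F' r + κ * F r) * Real.exp (κ * r)) r := fun r hr ↦ by
    have h := (hF' r hr).mul ((hasDerivAt_id r).const_mul κ).exp
    convert! h using 1
    simp only [id]
    ring
  refine antitoneOn_of_hasDerivWithinAt_nonpos (convex_Ici 0)
    (f' := fun r ↦ (F' r + κ * F r) * Real.exp (κ * r))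
    (fun r hr ↦ (hd r hr).continuousAt.continuousWithinAt)
    (fun r hr ↦ (hd r (interior_subset hr)).hasDerivWithinAt) fun r hr ↦ ?_
  exact mul_nonpos_of_nonpos_of_nonneg (hode r (interior_subset hr)) (Real.exp_nonneg _)

open Filter Topology in
/-- Let `κ > 0`, `q ≥ 0`, and let `F : [0,∞) → [0,∞)` be continuously
differentiable, nonincreasing, with `F'(t) + κ F(t) ≤ 0` for `t ≥ 0`. With
`F_q(t) = ∫_t^∞ r^q (-F'(r)) dr`, for every `t ≥ 0` one has
`F_q(t) ≤ F_q(0) (κ^{q+1}/Γ(q+1)) ∫_t^∞ r^q e^{-κr} dr`. -/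
theorem stmt_6 (κ q : ℝ) (hκ : 0 < κ) (hq : 0 ≤ q)
    (F F' : ℝ → ℝ)
    (hF' : ∀ t ∈ Ici (0:ℝ), HasDerivAt F (F' t) t)
    (hF'cont : ContinuousOn F' (Ici 0))
    (hFnonneg : ∀ t ∈ Ici (0:ℝ), 0 ≤ F t)
    (hFmono : AntitoneOn F (Ici 0))
    (hode : ∀ t ∈ Ici (0:ℝ), F' t + κ * F t ≤ 0) :
    ∀ t ∈ Ici (0:ℝ),
      ∫⁻ r in Ioi t, ENNReal.ofReal (r ^ q * (-F' r)) ≤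
        (∫⁻ r in Ioi (0:ℝ), ENNReal.ofReal (r ^ q * (-F' r))) *
          ENNReal.ofReal ((κ ^ (q + 1) / Real.Gamma (q + 1)) *
            ∫ r in Ioi t, r ^ q * Real.exp (-κ * r)) := by
  set f : ℝ → ℝ := fun r ↦ r ^ q * (-F' r) with hf
  set E : ℝ → ℝ := fun r ↦ r ^ q * Real.exp (-κ * r) with hE
  have hpow : Continuous fun r : ℝ ↦ r ^ q := Real.continuous_rpow_const hq
  have hEcont : Continuous E := by fun_prop
  have hfcont : ContinuousOn f (Ici 0) := hpow.continuousOn.mul hF'cont.neg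
  have hf0 : ∀ r ∈ Ici (0 : ℝ), 0 ≤ f r := fun r hr ↦
    mul_nonneg (Real.rpow_nonneg hr _)
      (by linarith [hode r hr, mul_nonneg hκ.le (hFnonneg r hr)])
  have hE0 : ∀ r ∈ Ici (0 : ℝ), 0 ≤ E r := fun r hr ↦
    mul_nonneg (Real.rpow_nonneg hr _) (Real.exp_nonneg _)
  have hEint : IntegrableOn E (Ioi 0) := by
    simpa [hE] using integrableOn_rpow_mul_exp_neg_mul_rpow (s := q) (p := 1) (by linarith) one_pos hκ
  have hEΓ : ∫ r in Ioi 0, E r = Real.Gamma (q + 1) / κ ^ (q + 1) := by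
    have h := Real.integral_rpow_mul_exp_neg_mul_Ioi (a := q + 1) (by linarith) hκ
    rw [add_sub_cancel_right, one_div, Real.inv_rpow hκ.le, mul_comm, ← div_eq_mul_inv] at h
    simpa only [hE, neg_mul] using h
  have hfII : ∀ a b, 0 ≤ a → a ≤ b → IntervalIntegrable f volume a b := fun a b ha hab ↦
    (hfcont.mono (Icc_subset_Ici_self.trans
      (Ici_subset_Ici.2 ha))).intervalIntegrable_of_Icc hab
  have hanti := antitoneOn_mul_exp_of_deriv_add_mul_nonpos hF' hode
  have hexp : ∀ s r, F s * Real.exp (κ * s) * Real.exp (-κ * r) - F r =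
      (F s * Real.exp (κ * s) - F r * Real.exp (κ * r)) * Real.exp (-κ * r) := fun s r ↦ by
    rw [sub_mul, mul_assoc (F r), ← Real.exp_add]
    simp
  have hψ : ∀ c, ∀ r ∈ Ici (0 : ℝ), HasDerivAt (fun r ↦ c * Real.exp (-κ * r) - F r)
      (-(c * κ * Real.exp (-κ * r)) - F' r) r := fun c r hr ↦ by
    have h := (((hasDerivAt_id r).const_mul (-κ)).exp.const_mul c).sub (hF' r hr)
    convert! h using 1
    simp only [id]
    ring
  have hψcont : ∀ c, ContinuousOn (fun r ↦ -(c * κ * Real.exp (-κ * r)) - F' r) (Ici 0) :=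
    fun c ↦ (by fun_prop : Continuous fun r ↦ -(c * κ * Real.exp (-κ * r))).continuousOn.sub hF'cont
  have hsplit : ∀ c a b, 0 ≤ a → a ≤ b →
      ∫ r in a..b, r ^ q * (-(c * κ * Real.exp (-κ * r)) - F' r) =
        (∫ r in a..b, f r) - c * κ * ∫ r in a..b, E r := fun c a b ha hab ↦ by
    rw [← intervalIntegral.integral_const_mul, ← intervalIntegral.integral_sub (hfII a b ha hab)
      ((hEcont.const_mul _).intervalIntegrable _ _)]
    congr 1 with r
    simp only [hf, hE]
    ring
  have htail : ∀ t ∈ Ici (0 : ℝ), IntegrableOn f (Ioi t) ∧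
      ∫ r in Ioi t, f r ≤ F t * Real.exp (κ * t) * κ * ∫ r in Ioi t, E r := fun t ht ↦ by
    rw [mem_Ici] at ht
    set c := F t * Real.exp (κ * t) with hc
    have hIci : ∀ r ∈ Ici t, r ∈ Ici (0 : ℝ) := fun r hr ↦ ht.trans hr
    refine integrableOn_Ioi_and_integral_le_of_intervalIntegral_le
      (B := fun T ↦ c * κ * (∫ r in t..T, E r) + c * E T) (hfcont.mono hIci)
      (fun r hr ↦ hf0 r (hIci r hr)) ?_ fun T hT ↦ ?_
    · have h1 := (intervalIntegral_tendsto_integral_Ioi t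
        (hEint.mono_set (Ioi_subset_Ioi ht)) tendsto_id).const_mul (c * κ)
      have h2 := (tendsto_rpow_mul_exp_neg_mul_atTop_nhds_zero q κ hκ).const_mul c
      simpa [hE] using h1.add h2
    · have hψ0 : c * Real.exp (-κ * t) - F t = 0 := by rw [hexp]; simp
      have h := rpow_mul_sub_le_integral_rpow_mul_deriv hq ht hT
        (fun r hr ↦ (hψ c r (hIci r hr.1)).neg)
        ((hψcont c).mono fun r hr ↦ hIci r hr.1).neg (fun r hr ↦ by
          rw [Pi.neg_apply, neg_nonpos, hexp]
          exact mul_nonneg (sub_nonneg.2 (hanti ht (hIci r hr.1) hr.1)) (Real.exp_nonneg _))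
      simp only [Pi.neg_apply, mul_neg, intervalIntegral.integral_neg, hψ0, hsplit c t T ht hT] at h
      have hT0 : 0 ≤ T ^ q * F T :=
        mul_nonneg (Real.rpow_nonneg (ht.trans hT) _) (hFnonneg T (hIci T hT))
      simp only [hE] at h ⊢
      linarith
  intro t ht
  obtain ⟨hft, hle⟩ := htail t ht
  have hf_int := (htail 0 self_mem_Ici).1
  rw [mem_Ici] at ht
  have hhead : F t * Real.exp (κ * t) * κ * (∫ r in (0 : ℝ)..t, E r) ≤ ∫ r in (0 : ℝ)..t, f r := by
    set c := F t * Real.exp (κ * t) with hc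
    have hψ0 : c * Real.exp (-κ * t) - F t = 0 := by rw [hexp]; simp
    have hneg : ∀ r ∈ Icc 0 t, c * Real.exp (-κ * r) - F r ≤ 0 := fun r hr ↦ by
      rw [hexp]
      exact mul_nonpos_of_nonpos_of_nonneg (sub_nonpos.2 (hanti hr.1 ht hr.2)) (Real.exp_nonneg _)
    have h := rpow_mul_sub_le_integral_rpow_mul_deriv hq le_rfl ht
      (fun r hr ↦ hψ c r hr.1) ((hψcont c).mono Icc_subset_Ici_self) hneg
    rw [hsplit c 0 t le_rfl ht, hψ0] at h
    have h0 := mul_nonpos_of_nonneg_of_nonpos (Real.rpow_nonneg le_rfl q)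
      (hneg 0 (left_mem_Icc.2 ht))
    linarith
  have hfsum := intervalIntegral.integral_interval_add_Ioi hf_int hft
  have hEt := hEint.mono_set (Ioi_subset_Ioi ht)
  have hEsum := intervalIntegral.integral_interval_add_Ioi hEint hEt
  have hEhead : 0 ≤ ∫ r in (0 : ℝ)..t, E r :=
    intervalIntegral.integral_nonneg ht fun r hr ↦ hE0 r hr.1
  have hEtail : 0 ≤ ∫ r in Ioi t, E r :=
    setIntegral_nonneg measurableSet_Ioi fun r hr ↦ hE0 r (ht.trans (le_of_lt hr))
  have hΓ : 0 < Real.Gamma (q + 1) := Real.Gamma_pos_of_pos (by linarith)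
  have hκq : 0 < κ ^ (q + 1) := Real.rpow_pos_of_pos hκ _
  have hcross : (∫ r in Ioi t, f r) * (∫ r in Ioi 0, E r) ≤
      (∫ r in Ioi 0, f r) * ∫ r in Ioi t, E r := by
    rw [← hfsum, ← hEsum]
    nlinarith [mul_le_mul_of_nonneg_right hle hEhead, mul_le_mul_of_nonneg_right hhead hEtail]
  have hreal : ∫ r in Ioi t, f r ≤
      (∫ r in Ioi 0, f r) * (κ ^ (q + 1) / Real.Gamma (q + 1) * ∫ r in Ioi t, E r) := by
    rw [hEΓ, ← mul_div_assoc, div_le_iff₀ hκq] at hcross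
    rw [div_mul_eq_mul_div, ← mul_div_assoc, le_div_iff₀ hΓ]
    linarith
  have hof : ∀ s, 0 ≤ s → IntegrableOn f (Ioi s) →
      ∫⁻ r in Ioi s, ENNReal.ofReal (f r) = ENNReal.ofReal (∫ r in Ioi s, f r) := fun s hs hi ↦
    (ofReal_integral_eq_lintegral_ofReal hi ((ae_restrict_iff' measurableSet_Ioi).2
      (ae_of_all _ fun r hr ↦ hf0 r (hs.trans (le_of_lt hr))))).symm
  rw [hof t ht hft, hof 0 le_rfl hf_int, ← ENNReal.ofReal_mul
    (setIntegral_nonneg measurableSet_Ioi fun r hr ↦ hf0 r (le_of_lt hr))]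
  exact ENNReal.ofReal_le_ofReal hreal
end

section
/- Let n ≥ 2 be an integer, let α ∈ (0,n), and let f : ℝⁿ → ℝ be measurable with ∫_{ℝⁿ} |f|^{n/α} dH^n < ∞. Suppose the Riesz potential u(x) = (Γ((n−α)/2)/(2^α π^{n/2} Γ(α/2))) · ∫_{ℝⁿ} f(y) |x−y|^{α−n} dH^n(y) converges absolutely for every x ∈ ℝⁿ. Then w = e^{nu} is a strong A_∞-weight: (a) there exist ε > 0 and C₁ ≥ 1 such that for every Euclidean ball B ⊂ ℝⁿ, ((H^n(B))^{−1} ∫_B w^{1+ε} dH^n)^{1/(1+ε)} ≤ C₁ · (H^n(B))^{−1} ∫_B w dH^n; and (b) there exist a metric d on ℝⁿ and C₂ ≥ 1 such that for all x, y ∈ ℝⁿ, C₂^{−1} d(x,y) ≤ (∫_{B_{|x−y|}(x) ∪ B_{|x−y|}(y)} w dH^n)^{1/n} ≤ C₂ d(x,y). -/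
open MeasureTheory Metric Set ENNReal

section RadialIntegrals

variable {E : Type*} [NormedAddCommGroup E] [NormedSpace ℝ E] [FiniteDimensional ℝ E]
  [Nontrivial E] [MeasureSpace E] [BorelSpace E] [(volume : Measure E).IsAddHaarMeasure]

/-- Polar coordinates for the integral of a nonnegative radial function over a radial region. -/
lemma setLIntegral_radial {n : ℕ} (hn : Module.finrank ℝ E = n) (z : E) {T : Set ℝ}
    (hT : MeasurableSet T) {g ψ : ℝ → ℝ} (hg : ∀ t, 0 ≤ t → 0 ≤ g t)
    (hψ : ∀ t ∈ T ∩ Ioi 0, t ^ (n - 1) * g t = ψ t)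
    (hint : IntegrableOn ψ (T ∩ Ioi 0)) :
    ∫⁻ y in {y : E | ‖z - y‖ ∈ T}, ENNReal.ofReal (g ‖z - y‖) =
      ENNReal.ofReal (n * volume.real (ball (0 : E) 1) * ∫ t in T ∩ Ioi 0, ψ t) := by
  have hms : MeasurableSet {y : E | ‖z - y‖ ∈ T} :=
    hT.preimage (by fun_prop : Measurable fun y : E => ‖z - y‖)
  have h1 : ∫⁻ y in {y : E | ‖z - y‖ ∈ T}, ENNReal.ofReal (g ‖z - y‖) =
      ∫⁻ y : E, ENNReal.ofReal (T.indicator g ‖z - y‖) := by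
    rw [← lintegral_indicator hms]
    congr 1 with y
    by_cases h : ‖z - y‖ ∈ T <;> simp [indicator, h]
  have hEq : EqOn (fun t : ℝ => t ^ (n - 1) • T.indicator g t) (T.indicator ψ) (Ioi 0) := by
    intro t ht
    by_cases h : t ∈ T
    · simpa [indicator, h] using hψ t ⟨h, ht⟩
    · simp [indicator, h]
  have hi : IntegrableOn (fun t : ℝ => t ^ (n - 1) • T.indicator g t) (Ioi 0) := by
    rw [integrableOn_congr_fun hEq measurableSet_Ioi]
    rw [IntegrableOn, integrable_indicator_iff hT, IntegrableOn, Measure.restrict_restrict hT]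
    exact hint
  rw [h1, lintegral_sub_left_eq_self (fun y : E => ENNReal.ofReal (T.indicator g ‖y‖)) z,
    ← ofReal_integral_eq_lintegral_ofReal]
  · rw [integral_fun_norm_addHaar, hn, nsmul_eq_mul, smul_eq_mul, mul_assoc,
      setIntegral_congr_fun measurableSet_Ioi hEq, setIntegral_indicator hT, inter_comm]
  · rw [integrable_fun_norm_addHaar, hn]; exact hi
  · exact Filter.Eventually.of_forall fun y => indicator_apply_nonneg fun _ => hg _ (norm_nonneg _)

omit [MeasureSpace E] [BorelSpace E] [(volume : Measure E).IsAddHaarMeasure] in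
lemma finrank_ne_zero_of_eq {n : ℕ} (hn : Module.finrank ℝ E = n) : 1 ≤ n :=
  hn ▸ Module.finrank_pos

lemma pow_pred_mul_rpow_neg {n : ℕ} (hn : 1 ≤ n) {t : ℝ} (ht : 0 < t) :
    t ^ (n - 1) * t ^ (-(n : ℝ)) = t⁻¹ := by
  rw [← Real.rpow_natCast, ← Real.rpow_add ht, ← Real.rpow_neg_one]
  congr 1
  push_cast [hn]
  ring

lemma setLIntegral_rpow_neg_mul_rpow_le {n : ℕ} (hn : Module.finrank ℝ E = n) (z : E)
    {θ R a : ℝ} (hθ : 0 < θ) (hR : 0 < R) (ha : 0 < a) :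
    ∫⁻ y in {y : E | ‖z - y‖ ∈ Iio (a * R)},
        ENNReal.ofReal (‖z - y‖ ^ (-(n : ℝ)) * (‖z - y‖ / R) ^ θ) ≤
      ENNReal.ofReal (n * volume.real (ball (0 : E) 1) * (a ^ θ / θ)) := by
  have h1 := finrank_ne_zero_of_eq hn
  have hset : Iio (a * R) ∩ Ioi 0 = Ioo 0 (a * R) := by rw [inter_comm]; rfl
  have hint : IntegrableOn (fun t : ℝ => R ^ (-θ) * t ^ (θ - 1)) (Ioo 0 (a * R)) :=
    (((intervalIntegral.integrableOn_Ioo_rpow_iff (by positivity)).2 (by linarith))).const_mul _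
  rw [setLIntegral_radial hn z measurableSet_Iio (g := fun t => t ^ (-(n : ℝ)) * (t / R) ^ θ)
    (ψ := fun t => R ^ (-θ) * t ^ (θ - 1)) (fun t ht => by positivity)]
  · refine ENNReal.ofReal_le_ofReal ?_
    gcongr
    rw [hset, ← integral_Ioc_eq_integral_Ioo, ← intervalIntegral.integral_of_le (by positivity),
      intervalIntegral.integral_const_mul, integral_rpow (Or.inl (by linarith))]
    rw [sub_add_cancel, Real.zero_rpow hθ.ne', sub_zero, Real.mul_rpow ha.le hR.le,
      Real.rpow_neg hR.le]
    have := Real.rpow_pos_of_pos hR θ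
    apply le_of_eq
    field_simp
  · rintro t ⟨-, ht : 0 < t⟩
    rw [← mul_assoc, pow_pred_mul_rpow_neg h1 ht, Real.div_rpow ht.le hR.le, Real.rpow_sub ht,
      Real.rpow_neg hR.le, Real.rpow_one]
    field_simp
  · rwa [hset]

lemma setLIntegral_rpow_neg_mul_div_le {n : ℕ} (hn : Module.finrank ℝ E = n) (z : E)
    {R : ℝ} (hR : 0 < R) :
    ∫⁻ y in {y : E | ‖z - y‖ ∈ Ici R},
        ENNReal.ofReal (‖z - y‖ ^ (-(n : ℝ)) * (R / ‖z - y‖)) ≤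
      ENNReal.ofReal (n * volume.real (ball (0 : E) 1)) := by
  have h1 := finrank_ne_zero_of_eq hn
  have hset : Ici R ∩ Ioi 0 = Ici R := inter_eq_left.2 fun t ht => hR.trans_le ht
  have hint : IntegrableOn (fun t : ℝ => R * t ^ (-2 : ℝ)) (Ici R) :=
    ((integrableOn_Ici_iff_integrableOn_Ioi).2
      (integrableOn_Ioi_rpow_of_lt (by norm_num) hR)).const_mul _
  rw [setLIntegral_radial hn z measurableSet_Ici (g := fun t => t ^ (-(n : ℝ)) * (R / t))
    (ψ := fun t => R * t ^ (-2 : ℝ)) (fun t ht => by positivity)]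
  · refine ENNReal.ofReal_le_ofReal ?_
    rw [hset, integral_Ici_eq_integral_Ioi, integral_const_mul,
      integral_Ioi_rpow_of_lt (by norm_num) hR]
    norm_num [Real.rpow_neg_one, hR.ne']
  · rintro t ⟨-, ht : 0 < t⟩
    rw [← mul_assoc, pow_pred_mul_rpow_neg h1 ht, Real.rpow_neg ht.le, Real.rpow_two]
    field_simp
  · rwa [hset]

lemma setLIntegral_rpow_neg_le_log {n : ℕ} (hn : Module.finrank ℝ E = n) (z : E)
    {δ S : ℝ} (hδ : 0 < δ) (hδS : δ ≤ S) :
    ∫⁻ y in {y : E | ‖z - y‖ ∈ Ico δ S}, ENNReal.ofReal (‖z - y‖ ^ (-(n : ℝ))) ≤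
      ENNReal.ofReal (n * volume.real (ball (0 : E) 1) * Real.log (S / δ)) := by
  have h1 := finrank_ne_zero_of_eq hn
  have hset : Ico δ S ∩ Ioi 0 = Ico δ S := inter_eq_left.2 fun t ht => hδ.trans_le ht.1
  have hint : IntegrableOn (fun t : ℝ => t⁻¹) (Ico δ S) := by
    refine (ContinuousOn.integrableOn_Icc ?_).mono_set Ico_subset_Icc_self
    exact continuousOn_inv₀.mono fun t ht => (hδ.trans_le ht.1).ne'
  rw [setLIntegral_radial hn z measurableSet_Ico (g := fun t => t ^ (-(n : ℝ)))
    (ψ := fun t => t⁻¹) (fun t ht => by positivity)]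
  · rw [hset, integral_Ico_eq_integral_Ioo, ← integral_Ioc_eq_integral_Ioo,
      ← intervalIntegral.integral_of_le hδS, integral_inv_of_pos hδ (hδ.trans_le hδS)]
  · rintro t ⟨-, ht : 0 < t⟩
    exact pow_pred_mul_rpow_neg h1 ht
  · rwa [hset]

end RadialIntegrals

section Kernel

/-- Young's inequality for a multiple of the Riesz kernel, with the weight `(R / ρ) ^ τ`. -/
lemma mul_rieszKernel_le {ν α a η ρ R : ℝ} (τ : ℝ) (hα : 0 < α) (hαν : α < ν) (ha : 0 ≤ a)
    (hη : 0 < η) (hρ : 0 ≤ ρ) (hR : 0 < R) :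
    a * ρ ^ (α - ν) ≤ η * (a ^ (ν / α) / η ^ (ν / α) * (R / ρ) ^ τ +
      ρ ^ (-ν) * (ρ / R) ^ (τ * (α / (ν - α)))) := by
  rcases hρ.eq_or_lt with rfl | hρ
  · rw [Real.zero_rpow (by linarith), mul_zero]
    have := hα.trans hαν
    positivity
  have hν : 0 < ν := hα.trans hαν
  have hd : 0 < ν - α := sub_pos.2 hαν
  have hpq : (ν / α).HolderConjugate (ν / (ν - α)) := by
    rw [Real.holderConjugate_iff]
    refine ⟨(one_lt_div hα).2 hαν, ?_⟩
    field_simp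
    ring
  set p := ν / α with hp
  have hp0 : 0 < p := by positivity
  set A := a / η * (R / ρ) ^ (τ / p)
  set B := ρ ^ (α - ν) * (ρ / R) ^ (τ / p)
  have hA : 0 ≤ A := by positivity
  have hB : 0 ≤ B := by positivity
  have hAB : a * ρ ^ (α - ν) = η * (A * B) := by
    have : (R / ρ) ^ (τ / p) * (ρ / R) ^ (τ / p) = 1 := by
      rw [← Real.mul_rpow (by positivity) (by positivity)]
      rw [div_mul_div_cancel₀ hρ.ne', div_self hR.ne', Real.one_rpow]
    calc a * ρ ^ (α - ν) = η * (a / η * ρ ^ (α - ν)) := by field_simp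
      _ = η * (a / η * ρ ^ (α - ν) * ((R / ρ) ^ (τ / p) * (ρ / R) ^ (τ / p))) := by
        rw [this, mul_one]
      _ = _ := by ring
  have hAp : A ^ p = a ^ p / η ^ p * (R / ρ) ^ τ := by
    rw [Real.mul_rpow (by positivity) (by positivity), Real.div_rpow ha hη.le,
      ← Real.rpow_mul (by positivity), div_mul_cancel₀ _ hp0.ne']
  have hBq : B ^ (ν / (ν - α)) = ρ ^ (-ν) * (ρ / R) ^ (τ * (α / (ν - α))) := by
    rw [Real.mul_rpow (by positivity) (by positivity), ← Real.rpow_mul hρ.le,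
      ← Real.rpow_mul (by positivity)]
    congr 2
    · field_simp
      ring
    · rw [hp]
      field_simp
  rw [hAB, ← hAp, ← hBq]
  gcongr
  refine (Real.young_inequality_of_nonneg hA hB hpq).trans ?_
  gcongr
  · exact div_le_self (by positivity) hpq.lt.le
  · exact div_le_self (by positivity) hpq.symm.lt.le

lemma one_sub_le_rpow_neg {β h : ℝ} (hβ : 0 ≤ β) (hh : 0 ≤ h) : 1 - β * h ≤ (1 + h) ^ (-β) := by
  rw [Real.rpow_def_of_pos (by linarith)]
  have h1 := Real.add_one_le_exp (Real.log (1 + h) * -β)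
  have h2 : Real.log (1 + h) ≤ h := by
    have := Real.log_le_sub_one_of_pos (show 0 < 1 + h by linarith)
    linarith
  nlinarith

lemma rpow_neg_sub_rpow_neg_le {β s t : ℝ} (hβ : 0 ≤ β) (hs : 0 < s) (hst : s ≤ t) :
    s ^ (-β) - t ^ (-β) ≤ β * s ^ (-β) * ((t - s) / s) := by
  have ht : t = s * (1 + (t - s) / s) := by field_simp; ring
  have h0 : 0 ≤ (t - s) / s := div_nonneg (by linarith) hs.le
  have h1 := one_sub_le_rpow_neg hβ h0
  have h2 : t ^ (-β) = s ^ (-β) * (1 + (t - s) / s) ^ (-β) := by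
    rw [← Real.mul_rpow hs.le (by positivity), ← ht]
  rw [h2]
  have := Real.rpow_pos_of_pos hs (-β)
  nlinarith

lemma abs_rpow_neg_sub_rpow_neg_le {β s t R : ℝ} (hβ : 0 < β) (ht : 0 < t)
    (hts : t / 2 ≤ s) (hR : |s - t| ≤ R) :
    |s ^ (-β) - t ^ (-β)| ≤ β * 2 ^ (β + 1) * (t ^ (-β) * (R / t)) := by
  have hR0 : 0 ≤ R := (abs_nonneg _).trans hR
  have hs : 0 < s := by linarith
  have key : ∀ r : ℝ, t / 2 ≤ r → β * r ^ (-β) * (R / r) ≤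
      β * 2 ^ (β + 1) * (t ^ (-β) * (R / t)) := by
    intro r hr
    have hr0 : 0 < r := by linarith
    calc β * r ^ (-β) * (R / r) ≤ β * (t / 2) ^ (-β) * (R / (t / 2)) := by
          have := Real.rpow_le_rpow_of_nonpos (by positivity) hr (neg_nonpos.2 hβ.le)
          gcongr
      _ = _ := by
          rw [Real.div_rpow ht.le (by norm_num), Real.rpow_add (by norm_num),
            Real.rpow_neg (by norm_num : (0 : ℝ) ≤ 2)]
          have : (0 : ℝ) < 2 ^ β := by positivity
          field_simp
          norm_num
  rcases le_total s t with h | h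
  · have hmono := Real.rpow_le_rpow_of_nonpos hs h (neg_nonpos.2 hβ.le)
    rw [abs_of_nonneg (by linarith)]
    refine (rpow_neg_sub_rpow_neg_le hβ.le hs h).trans (le_trans ?_ (key s hts))
    rw [abs_of_nonpos (by linarith)] at hR
    gcongr
    linarith
  · have hmono := Real.rpow_le_rpow_of_nonpos ht h (neg_nonpos.2 hβ.le)
    rw [abs_of_nonpos (by linarith), neg_sub]
    refine (rpow_neg_sub_rpow_neg_le hβ.le ht h).trans (le_trans ?_ (key t (by linarith)))
    rw [abs_of_nonneg (by linarith)] at hR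
    gcongr

end Kernel

section TruncatedPotential

variable {E : Type*} [NormedAddCommGroup E] [MeasureSpace E]

/-- The truncated Riesz-type potential `∫_{|z - y| ≥ ρ} h y |z - y| ^ γ dy`. -/
noncomputable def truncatedPotential (γ : ℝ) (h : E → ℝ) (z : E) (ρ : ℝ) : ℝ :=
  ∫ y in {y : E | ‖z - y‖ ∈ Ici ρ}, h y * ‖z - y‖ ^ γ

/-- The contribution of the points of `ball x r` at distance at least `ρ` from `z` to the
Riesz-type potential of `|h|` at `z`. -/
noncomputable def nearPotential (γ : ℝ) (h : E → ℝ) (z : E) (ρ : ℝ) (x : E) (r : ℝ) : ℝ≥0∞ :=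
  ∫⁻ y in {y : E | ‖z - y‖ ∈ Ici ρ} ∩ ball x r, ENNReal.ofReal (|h y| * ‖z - y‖ ^ γ)

variable [NormedSpace ℝ E] [FiniteDimensional ℝ E]
  [Nontrivial E] [BorelSpace E] [(volume : Measure E).IsAddHaarMeasure]

lemma ofReal_mul_rieszKernel_le {ν α a η ρ R : ℝ} (τ : ℝ) (hα : 0 < α) (hαν : α < ν) (ha : 0 ≤ a)
    (hη : 0 < η) (hρ : 0 ≤ ρ) (hR : 0 < R) :
    ENNReal.ofReal (a * ρ ^ (α - ν)) ≤ ENNReal.ofReal η *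
      (ENNReal.ofReal (a ^ (ν / α) / η ^ (ν / α)) * ENNReal.ofReal ((R / ρ) ^ τ) +
      ENNReal.ofReal (ρ ^ (-ν) * (ρ / R) ^ (τ * (α / (ν - α))))) := by
  rw [← ENNReal.ofReal_mul (by positivity), ← ENNReal.ofReal_add (by positivity) (by positivity),
    ← ENNReal.ofReal_mul hη.le]
  exact ENNReal.ofReal_le_ofReal (mul_rieszKernel_le τ hα hαν ha hη hρ hR)

omit [NormedSpace ℝ E] [FiniteDimensional ℝ E] [Nontrivial E]
  [(volume : Measure E).IsAddHaarMeasure] in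
lemma measurableSet_norm_sub_mem (z : E) {T : Set ℝ} (hT : MeasurableSet T) :
    MeasurableSet {y : E | ‖z - y‖ ∈ T} :=
  hT.preimage (by fun_prop : Measurable fun y : E => ‖z - y‖)

lemma setLIntegral_kernel_mul_div_le {n : ℕ} (hn : Module.finrank ℝ E = n) {α η R : ℝ}
    (hα : 0 < α) (hαn : α < n) {h : E → ℝ} (hh : Measurable h) (hη : 0 < η)
    (hF : ∫⁻ y, ENNReal.ofReal (|h y| ^ ((n : ℝ) / α) / η ^ ((n : ℝ) / α)) ≤ 1)
    (z : E) (hR : 0 < R) :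
    ∫⁻ y in {y : E | ‖z - y‖ ∈ Ici R},
        ENNReal.ofReal (|h y| * ‖z - y‖ ^ (α - n) * (R / ‖z - y‖)) ≤
      ENNReal.ofReal (η * (1 + n * volume.real (ball (0 : E) 1))) := by
  calc _ ≤ ∫⁻ y in {y : E | ‖z - y‖ ∈ Ici R}, ENNReal.ofReal η *
        (ENNReal.ofReal (|h y| ^ ((n : ℝ) / α) / η ^ ((n : ℝ) / α)) +
          ENNReal.ofReal (‖z - y‖ ^ (-(n : ℝ)) * (R / ‖z - y‖))) := by
        refine setLIntegral_mono' (measurableSet_norm_sub_mem z measurableSet_Ici) ?_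
        intro y (hy : R ≤ ‖z - y‖)
        have h1 : R / ‖z - y‖ ≤ 1 := (div_le_one (hR.trans_le hy)).2 hy
        rw [ENNReal.ofReal_mul (by positivity)]
        calc _ ≤ _ := mul_le_mul_left (ofReal_mul_rieszKernel_le 0 hα hαn (abs_nonneg (h y)) hη
                (norm_nonneg (z - y)) hR) _
          _ ≤ _ := by
            simp only [Real.rpow_zero, ENNReal.ofReal_one, mul_one, zero_mul]
            rw [mul_assoc, add_mul, ENNReal.ofReal_mul (p := ‖z - y‖ ^ (-(n : ℝ))) (by positivity)]
            gcongr
            exact mul_le_of_le_one_right' (by simpa using h1)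
    _ ≤ ENNReal.ofReal η * (1 + ENNReal.ofReal (n * volume.real (ball (0 : E) 1))) := by
        rw [lintegral_const_mul' _ _ ENNReal.ofReal_ne_top, lintegral_add_left (by fun_prop)]
        gcongr
        · exact (setLIntegral_le_lintegral _ _).trans hF
        · exact setLIntegral_rpow_neg_mul_div_le hn z hR
    _ = _ := by
        rw [ENNReal.ofReal_mul hη.le, ENNReal.ofReal_add zero_le_one (by positivity)]
        simp

/-- Oscillation of truncated potentials: up to a multiple of `η`, the difference between the
potential at `z` truncated at scale `ρ` and that at `x` truncated at scale `S` is controlled by the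
contribution of `ball x (2 * S)` to the former. -/
lemma ofReal_abs_truncatedPotential_sub_le {n : ℕ} (hn : Module.finrank ℝ E = n) {α η S ρ : ℝ}
    (hα : 0 < α) (hαn : α < n) {h : E → ℝ} (hh : Measurable h) (hη : 0 < η)
    (hF : ∫⁻ y, ENNReal.ofReal (|h y| ^ ((n : ℝ) / α) / η ^ ((n : ℝ) / α)) ≤ 1)
    (hconv : ∀ z : E, Integrable fun y => h y * ‖z - y‖ ^ (α - n))
    {x z : E} (hS : 0 < S) (hzx : ‖z - x‖ ≤ S) (hρS : ρ ≤ S) :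
    ENNReal.ofReal |truncatedPotential (α - n) h z ρ - truncatedPotential (α - n) h x S| ≤
      ENNReal.ofReal ((2 + (n - α) * 2 ^ (n - α + 1)) *
        (η * (1 + n * volume.real (ball (0 : E) 1)))) +
      nearPotential (α - n) h z ρ x (2 * S) := by
  have hmz := measurableSet_norm_sub_mem z (measurableSet_Ici (a := ρ))
  have hmx := measurableSet_norm_sub_mem x (measurableSet_Ici (a := S))
  set C : ℝ := 2 + (n - α) * 2 ^ ((n : ℝ) - α + 1) with hC
  have hd : 0 < (n : ℝ) - α := sub_pos.2 hαn
  have hC0 : 2 ≤ C := by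
    have : 0 ≤ (n - α) * 2 ^ ((n : ℝ) - α + 1) := by positivity
    linarith
  have hC1 : (n - α) * 2 ^ ((n : ℝ) - α + 1) ≤ C := by linarith
  have hmeas : Measurable fun y => ENNReal.ofReal (|h y| * ‖z - y‖ ^ (α - n)) := by fun_prop
  rw [truncatedPotential, truncatedPotential, nearPotential, ← integral_indicator hmz,
    ← integral_indicator hmx, ← integral_sub ((hconv z).indicator hmz) ((hconv x).indicator hmx),
    ← Real.norm_eq_abs, ofReal_norm]
  refine (enorm_integral_le_lintegral_enorm _).trans ?_
  rw [← lintegral_indicator (hmz.inter measurableSet_ball)]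
  calc _ ≤ ∫⁻ y, (({y : E | ‖z - y‖ ∈ Ici ρ} ∩ ball x (2 * S)).indicator
          (fun y => ENNReal.ofReal (|h y| * ‖z - y‖ ^ (α - n))) y +
        {y : E | ‖x - y‖ ∈ Ici S}.indicator (fun y => ENNReal.ofReal C *
          ENNReal.ofReal (|h y| * ‖x - y‖ ^ (α - n) * (S / ‖x - y‖))) y) := by
        refine lintegral_mono fun y => ?_
        rcases lt_or_ge ‖x - y‖ (2 * S) with hy | hy
        · have hyb : y ∈ ball x (2 * S) := by rwa [mem_ball', dist_eq_norm]
          refine enorm_sub_le.trans (add_le_add (le_of_eq ?_) ?_)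
          · by_cases hyz : y ∈ {y : E | ‖z - y‖ ∈ Ici ρ}
            · rw [indicator_of_mem hyz, indicator_of_mem
                (show y ∈ {y : E | ‖z - y‖ ∈ Ici ρ} ∩ ball x (2 * S) from ⟨hyz, hyb⟩), ← ofReal_norm,
                Real.norm_eq_abs, abs_mul, abs_of_nonneg (by positivity : 0 ≤ ‖z - y‖ ^ (α - n))]
            · rw [indicator_of_notMem hyz, indicator_of_notMem (fun H => hyz H.1), enorm_zero]
          · by_cases hyx : y ∈ {y : E | ‖x - y‖ ∈ Ici S}
            · rw [indicator_of_mem hyx, indicator_of_mem hyx, ← ofReal_norm,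
                Real.norm_eq_abs, abs_mul, abs_of_nonneg (by positivity : 0 ≤ ‖x - y‖ ^ (α - n)),
                ← ENNReal.ofReal_mul (by positivity)]
              refine ENNReal.ofReal_le_ofReal ?_
              have hpos : 0 < ‖x - y‖ := hS.trans_le hyx
              have : 1 ≤ C * (S / ‖x - y‖) := by
                rw [mul_div_assoc', one_le_div hpos]
                nlinarith
              calc _ ≤ |h y| * ‖x - y‖ ^ (α - n) * (C * (S / ‖x - y‖)) :=
                    le_mul_of_one_le_right (by positivity) this
                _ = _ := by ring
            · rw [indicator_of_notMem hyx, indicator_of_notMem hyx, enorm_zero]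
        · have hyb : y ∉ ball x (2 * S) := by rwa [mem_ball', dist_eq_norm, not_lt]
          have habs : |‖z - y‖ - ‖x - y‖| ≤ S := by
            refine (abs_norm_sub_norm_le _ _).trans ?_
            simpa using hzx
          have hzy : ‖x - y‖ - S ≤ ‖z - y‖ := by linarith [(abs_le.1 habs).1]
          have hyx : y ∈ {y : E | ‖x - y‖ ∈ Ici S} := show S ≤ ‖x - y‖ by linarith
          have hyz : y ∈ {y : E | ‖z - y‖ ∈ Ici ρ} := show ρ ≤ ‖z - y‖ by linarith
          have hyn : y ∉ {y : E | ‖z - y‖ ∈ Ici ρ} ∩ ball x (2 * S) := fun H => hyb H.2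
          rw [indicator_of_notMem hyn, zero_add, indicator_of_mem hyz,
            indicator_of_mem hyx, indicator_of_mem hyx, ← mul_sub, ← ofReal_norm,
            Real.norm_eq_abs, abs_mul, ← ENNReal.ofReal_mul (by positivity)]
          refine ENNReal.ofReal_le_ofReal ?_
          have := abs_rpow_neg_sub_rpow_neg_le hd (by linarith : 0 < ‖x - y‖)
            (by linarith : ‖x - y‖ / 2 ≤ ‖z - y‖) habs
          rw [neg_sub] at this
          calc _ ≤ |h y| * ((n - α) * 2 ^ ((n : ℝ) - α + 1) *
                (‖x - y‖ ^ (α - n) * (S / ‖x - y‖))) := by gcongr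
            _ ≤ |h y| * (C * (‖x - y‖ ^ (α - n) * (S / ‖x - y‖))) := by gcongr
            _ = _ := by ring
    _ ≤ _ := by
        rw [lintegral_add_left (hmeas.indicator (hmz.inter measurableSet_ball)), add_comm,
          lintegral_indicator hmx, lintegral_const_mul' _ _ ENNReal.ofReal_ne_top,
          ENNReal.ofReal_mul (by linarith)]
        gcongr
        exact setLIntegral_kernel_mul_div_le hn hα hαn hh hη hF x hS

end TruncatedPotential

section ExponentialIntegrability

variable {E : Type*} [NormedAddCommGroup E] [MeasureSpace E] [NormedSpace ℝ E]
  [FiniteDimensional ℝ E] [Nontrivial E] [BorelSpace E] [(volume : Measure E).IsAddHaarMeasure]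

/-- The Riesz-type potential `∫_{ball x (2 * R)} F y (R / |z - y|) ^ (n / 2) dy`, which dominates
exponentials of the critical potential. -/
noncomputable def halfPotential (n : ℕ) (F : E → ℝ≥0∞) (x : E) (R : ℝ) (z : E) : ℝ≥0∞ :=
  ∫⁻ y in ball x (2 * R), F y * ENNReal.ofReal ((R / ‖z - y‖) ^ ((n : ℝ) / 2))

lemma nearPotential_le_log {n : ℕ} (hn : Module.finrank ℝ E = n) {α η R : ℝ}
    (hα : 0 < α) (hαn : α < n) {h : E → ℝ} (hh : Measurable h) (hη : 0 < η)
    (hF : ∫⁻ y, ENNReal.ofReal (|h y| ^ ((n : ℝ) / α) / η ^ ((n : ℝ) / α)) ≤ 1)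
    {x z : E} (hR : 0 < R) (hzx : ‖z - x‖ ≤ R) {X : ℝ} (hX0 : 0 ≤ X)
    (hX : halfPotential n
      (fun y => ENNReal.ofReal (|h y| ^ ((n : ℝ) / α) / η ^ ((n : ℝ) / α))) x R z =
        ENNReal.ofReal X) :
    nearPotential (α - n) h z 0 x (2 * R) ≤
      ENNReal.ofReal (η * (2 + n * volume.real (ball (0 : E) 1) *
        (1 / ((n : ℝ) / 2 * (α / (n - α))) + Real.log 3) +
        2 * volume.real (ball (0 : E) 1) * Real.log (1 + X))) := by
  have hd : 0 < (n : ℝ) - α := sub_pos.2 hαn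
  have hn0 : 0 < (n : ℝ) := hα.trans hαn
  set ω := volume.real (ball (0 : E) 1)
  set θ := (n : ℝ) / 2 * (α / (n - α)) with hθ
  have hθ0 : 0 < θ := by positivity
  set T := 1 + X with hT
  have hT1 : 1 ≤ T := by linarith
  have hT0 : 0 < T := by linarith
  set δ := R * T ^ (-(2 / (n : ℝ))) with hδ
  have hδ0 : 0 < δ := by positivity
  have hδR : δ ≤ R := mul_le_of_le_one_right hR.le
    (Real.rpow_le_one_of_one_le_of_nonpos hT1 (neg_nonpos.2 (by positivity)))
  have hlog3 : 0 ≤ Real.log 3 := Real.log_nonneg (by norm_num)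
  have hlogT : 0 ≤ Real.log T := Real.log_nonneg hT1
  have hlog : Real.log (3 * R / δ) = Real.log 3 + 2 / n * Real.log T := by
    rw [Real.log_div (by positivity) hδ0.ne', hδ, Real.log_mul (by norm_num) hR.ne',
      Real.log_mul hR.ne' (by positivity), Real.log_rpow hT0]
    ring
  set F : E → ℝ≥0∞ := fun y => ENNReal.ofReal (|h y| ^ ((n : ℝ) / α) / η ^ ((n : ℝ) / α))
    with hFdef
  have hFm : Measurable F := by fun_prop
  have hms : MeasurableSet {y : E | ‖z - y‖ ∈ Iio δ} := measurableSet_norm_sub_mem z measurableSet_Iio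
  have hml : MeasurableSet {y : E | ‖z - y‖ ∈ Ico δ (3 * R)} :=
    measurableSet_norm_sub_mem z measurableSet_Ico
  have hsub : {y : E | ‖z - y‖ ∈ Ici 0} ∩ ball x (2 * R) ⊆
      ({y : E | ‖z - y‖ ∈ Iio δ} ∩ ball x (2 * R)) ∪ {y : E | ‖z - y‖ ∈ Ico δ (3 * R)} := by
    rintro y ⟨-, hy⟩
    rcases lt_or_ge ‖z - y‖ δ with h1 | h1
    · exact Or.inl ⟨h1, hy⟩
    · refine Or.inr ⟨h1, ?_⟩
      rw [mem_ball', dist_eq_norm] at hy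
      have := norm_sub_le_norm_sub_add_norm_sub z x y
      linarith
  have hnear : ∫⁻ y in {y : E | ‖z - y‖ ∈ Iio δ} ∩ ball x (2 * R),
      ENNReal.ofReal (|h y| * ‖z - y‖ ^ (α - n)) ≤
        ENNReal.ofReal (η * (1 + n * ω * (1 / θ))) := by
    calc _ ≤ ∫⁻ y in {y : E | ‖z - y‖ ∈ Iio δ} ∩ ball x (2 * R), ENNReal.ofReal η *
          (ENNReal.ofReal T⁻¹ * (F y * ENNReal.ofReal ((R / ‖z - y‖) ^ ((n : ℝ) / 2))) +
            ENNReal.ofReal (‖z - y‖ ^ (-(n : ℝ)) * (‖z - y‖ / δ) ^ θ)) := by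
          refine lintegral_mono fun y => ?_
          refine (ofReal_mul_rieszKernel_le ((n : ℝ) / 2) hα hαn (abs_nonneg (h y)) hη
            (norm_nonneg (z - y)) hδ0).trans (le_of_eq ?_)
          have : (δ / ‖z - y‖) ^ ((n : ℝ) / 2) = T⁻¹ * (R / ‖z - y‖) ^ ((n : ℝ) / 2) := by
            rw [hδ, mul_div_right_comm, Real.mul_rpow (by positivity) (by positivity),
              ← Real.rpow_mul hT0.le, mul_comm]
            congr 1
            rw [← Real.rpow_neg_one]
            congr 1
            field_simp
          rw [this, ENNReal.ofReal_mul (by positivity)]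
          ring
      _ ≤ ENNReal.ofReal η * (ENNReal.ofReal T⁻¹ * ENNReal.ofReal X +
            ENNReal.ofReal (n * ω * (1 ^ θ / θ))) := by
          rw [lintegral_const_mul' _ _ ENNReal.ofReal_ne_top, lintegral_add_left (by fun_prop),
            lintegral_const_mul' _ _ ENNReal.ofReal_ne_top, ← hX]
          gcongr
          · exact lintegral_mono_set inter_subset_right
          · refine (lintegral_mono_set inter_subset_left).trans ?_
            simpa using setLIntegral_rpow_neg_mul_rpow_le hn z hθ0 hδ0 one_pos
      _ ≤ _ := by
          rw [← ENNReal.ofReal_mul (by positivity),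
            ← ENNReal.ofReal_add (by positivity) (by positivity), ← ENNReal.ofReal_mul hη.le,
            Real.one_rpow]
          gcongr
          rw [inv_mul_le_iff₀ hT0]
          linarith
  have hfar : ∫⁻ y in {y : E | ‖z - y‖ ∈ Ico δ (3 * R)},
      ENNReal.ofReal (|h y| * ‖z - y‖ ^ (α - n)) ≤
        ENNReal.ofReal (η * (1 + n * ω * Real.log (3 * R / δ))) := by
    calc _ ≤ ∫⁻ y in {y : E | ‖z - y‖ ∈ Ico δ (3 * R)}, ENNReal.ofReal η *
          (F y + ENNReal.ofReal (‖z - y‖ ^ (-(n : ℝ)))) := by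
          refine lintegral_mono fun y => ?_
          simpa using ofReal_mul_rieszKernel_le 0 hα hαn (abs_nonneg (h y)) hη
            (norm_nonneg (z - y)) hδ0
      _ ≤ ENNReal.ofReal η * (1 + ENNReal.ofReal (n * ω * Real.log (3 * R / δ))) := by
          rw [lintegral_const_mul' _ _ ENNReal.ofReal_ne_top, lintegral_add_left hFm]
          gcongr
          · exact (setLIntegral_le_lintegral _ _).trans hF
          · exact setLIntegral_rpow_neg_le_log hn z hδ0 (by linarith)
      _ = _ := by
          have : 0 ≤ n * ω * Real.log (3 * R / δ) := by rw [hlog]; positivity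
          rw [ENNReal.ofReal_mul hη.le, ENNReal.ofReal_add zero_le_one this, ENNReal.ofReal_one]
  calc _ ≤ _ := lintegral_mono_set hsub
    _ ≤ _ := lintegral_union_le _ _ _
    _ ≤ _ := add_le_add hnear hfar
    _ = _ := by
      have : 0 ≤ n * ω * Real.log (3 * R / δ) := by rw [hlog]; positivity
      rw [← ENNReal.ofReal_add (by positivity) (by positivity), hlog]
      congr 1
      field_simp
      ring

lemma setLIntegral_halfPotential_le {n : ℕ} (hn : Module.finrank ℝ E = n) {F : E → ℝ≥0∞}
    (hFm : Measurable F) (hF : ∫⁻ y, F y ≤ 1) (x : E) {R : ℝ} (hR : 0 < R) :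
    ∫⁻ z in ball x R, halfPotential n F x R z ≤
      ENNReal.ofReal (2 * 3 ^ ((n : ℝ) / 2)) * volume (ball x R) := by
  have hn1 := finrank_ne_zero_of_eq hn
  have hn0 : 0 < (n : ℝ) := by exact_mod_cast hn1
  have hvol : volume (ball x R) = ENNReal.ofReal (R ^ n * volume.real (ball (0 : E) 1)) := by
    rw [Measure.addHaar_ball _ x hR.le, hn, ENNReal.ofReal_mul (by positivity),
      ofReal_measureReal measure_ball_lt_top.ne]
  have hm : Measurable fun p : E × E =>
      F p.2 * ENNReal.ofReal ((R / ‖p.1 - p.2‖) ^ ((n : ℝ) / 2)) := by fun_prop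
  unfold halfPotential
  rw [lintegral_lintegral_swap hm.aemeasurable]
  have hinner : ∀ y ∈ ball x (2 * R),
      ∫⁻ z in ball x R, F y * ENNReal.ofReal ((R / ‖z - y‖) ^ ((n : ℝ) / 2)) ≤
        F y * (ENNReal.ofReal (2 * 3 ^ ((n : ℝ) / 2)) * volume (ball x R)) := by
    intro y hy
    rw [lintegral_const_mul _ (by fun_prop)]
    gcongr
    have hsub : ball x R ⊆ {z : E | ‖y - z‖ ∈ Iio (3 * R)} := by
      intro z hz
      rw [mem_ball', dist_eq_norm] at hz
      rw [mem_ball, dist_eq_norm] at hy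
      have := norm_sub_le_norm_sub_add_norm_sub y x z
      show ‖y - z‖ < 3 * R
      linarith
    calc _ ≤ ∫⁻ z in {z : E | ‖y - z‖ ∈ Iio (3 * R)},
          ENNReal.ofReal ((R / ‖z - y‖) ^ ((n : ℝ) / 2)) := lintegral_mono_set hsub
      _ = ∫⁻ z in {z : E | ‖y - z‖ ∈ Iio (3 * R)}, ENNReal.ofReal (R ^ n) *
          ENNReal.ofReal (‖y - z‖ ^ (-(n : ℝ)) * (‖y - z‖ / R) ^ ((n : ℝ) / 2)) := by
          refine lintegral_congr fun z => ?_
          rw [← ENNReal.ofReal_mul (by positivity), norm_sub_rev z y]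
          congr 1
          rcases (norm_nonneg (y - z)).eq_or_lt with h0 | h0
          · have hne : (n : ℝ) / 2 ≠ 0 := by positivity
            simp [← h0, Real.zero_rpow hne]
          · rw [Real.div_rpow hR.le h0.le, Real.div_rpow h0.le hR.le, Real.rpow_neg h0.le,
              ← Real.rpow_natCast]
            have e1 : R ^ (n : ℝ) = R ^ ((n : ℝ) / 2) * R ^ ((n : ℝ) / 2) := by
              rw [← Real.rpow_add hR]; ring_nf
            have e2 : ‖y - z‖ ^ (n : ℝ) = ‖y - z‖ ^ ((n : ℝ) / 2) * ‖y - z‖ ^ ((n : ℝ) / 2) := by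
              rw [← Real.rpow_add h0]; ring_nf
            rw [e1, e2]
            have := Real.rpow_pos_of_pos h0 ((n : ℝ) / 2)
            have := Real.rpow_pos_of_pos hR ((n : ℝ) / 2)
            field_simp
      _ ≤ ENNReal.ofReal (R ^ n) * ENNReal.ofReal
          (n * volume.real (ball (0 : E) 1) * (3 ^ ((n : ℝ) / 2) / ((n : ℝ) / 2))) := by
          rw [lintegral_const_mul' _ _ ENNReal.ofReal_ne_top]
          gcongr
          exact setLIntegral_rpow_neg_mul_rpow_le hn y (by positivity) hR (by norm_num)
      _ = _ := by
          rw [hvol, ← ENNReal.ofReal_mul (by positivity), ← ENNReal.ofReal_mul (by positivity)]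
          congr 1
          field_simp
  calc _ ≤ ∫⁻ y in ball x (2 * R),
        F y * (ENNReal.ofReal (2 * 3 ^ ((n : ℝ) / 2)) * volume (ball x R)) :=
        setLIntegral_mono' measurableSet_ball hinner
    _ ≤ 1 * (ENNReal.ofReal (2 * 3 ^ ((n : ℝ) / 2)) * volume (ball x R)) := by
        rw [lintegral_mul_const _ hFm]
        gcongr
        exact (setLIntegral_le_lintegral _ _).trans hF
    _ = _ := one_mul _

/-- Exponential integrability over balls of the oscillation of a potential of small norm. -/
lemma exists_setLIntegral_exp_truncatedPotential_le {n : ℕ} (hn : Module.finrank ℝ E = n)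
    {α η κ : ℝ} (hα : 0 < α) (hαn : α < n) {h : E → ℝ} (hh : Measurable h) (hη : 0 < η)
    (hF : ∫⁻ y, ENNReal.ofReal (|h y| ^ ((n : ℝ) / α) / η ^ ((n : ℝ) / α)) ≤ 1)
    (hconv : ∀ z : E, Integrable fun y => h y * ‖z - y‖ ^ (α - n))
    (hκ : 0 ≤ κ) (hsmall : 2 * n * κ * (η * (2 * volume.real (ball (0 : E) 1))) ≤ 1) :
    ∃ C : ℝ, 0 < C ∧ ∀ (x : E) (R : ℝ), 0 < R →
      ∫⁻ z in ball x R, ENNReal.ofReal (Real.exp (2 * n * (κ *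
        |truncatedPotential (α - n) h z 0 - truncatedPotential (α - n) h x R|))) ≤
      ENNReal.ofReal C * volume (ball x R) := by
  set ω := volume.real (ball (0 : E) 1) with hω
  have hd : 0 < (n : ℝ) - α := sub_pos.2 hαn
  have hn0 : 0 < (n : ℝ) := hα.trans hαn
  set a := (2 + (n - α) * 2 ^ ((n : ℝ) - α + 1)) * (η * (1 + n * ω))
  set b := 2 + n * ω * (1 / ((n : ℝ) / 2 * (α / (n - α))) + Real.log 3) with hb
  have hlog3 : 0 ≤ Real.log 3 := Real.log_nonneg (by norm_num)
  have ha0 : 0 ≤ a := by positivity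
  have hb0 : 0 ≤ b := by positivity
  set F : E → ℝ≥0∞ := fun y => ENNReal.ofReal (|h y| ^ ((n : ℝ) / α) / η ^ ((n : ℝ) / α))
    with hFdef
  have hFm : Measurable F := by fun_prop
  set c := Real.exp (2 * n * κ * (a + η * b)) with hc
  have hc0 : 0 < c := Real.exp_pos _
  have hpt : ∀ (x : E) (R : ℝ), 0 < R → ∀ z ∈ ball x R,
      ENNReal.ofReal (Real.exp (2 * n * (κ *
        |truncatedPotential (α - n) h z 0 - truncatedPotential (α - n) h x R|))) ≤
      ENNReal.ofReal c * (1 + halfPotential n F x R z) := by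
    intro x R hR z hz
    by_cases htop : halfPotential n F x R z = ⊤
    · rw [htop, add_top, ENNReal.mul_top (by simpa using hc0)]
      exact le_top
    obtain ⟨X, hX0, hX⟩ : ∃ X : ℝ, 0 ≤ X ∧ halfPotential n F x R z = ENNReal.ofReal X :=
      ⟨_, ENNReal.toReal_nonneg, (ENNReal.ofReal_toReal htop).symm⟩
    have hzx : ‖z - x‖ ≤ R := by
      rw [mem_ball, dist_eq_norm] at hz
      exact hz.le
    have hlogT : 0 ≤ Real.log (1 + X) := Real.log_nonneg (by linarith)
    have h1 := (ofReal_abs_truncatedPotential_sub_le hn hα hαn hh hη hF hconv hR hzx hR.le).trans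
      (add_le_add le_rfl (nearPotential_le_log hn hα hαn hh hη hF hR hzx hX0 hX))
    rw [← hω, ← hb, ← ENNReal.ofReal_add ha0 (by positivity),
      ENNReal.ofReal_le_ofReal_iff (by positivity)] at h1
    rw [hX, ← ENNReal.ofReal_one, ← ENNReal.ofReal_add zero_le_one hX0,
      ← ENNReal.ofReal_mul hc0.le]
    refine ENNReal.ofReal_le_ofReal ?_
    calc _ ≤ Real.exp (2 * n * κ * (a + η * b) + Real.log (1 + X)) := by
          refine Real.exp_le_exp.2 ?_
          calc _ ≤ 2 * n * (κ * (a + η * (b + 2 * ω * Real.log (1 + X)))) := by gcongr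
            _ = 2 * n * κ * (a + η * b) + 2 * n * κ * (η * (2 * ω)) * Real.log (1 + X) := by ring
            _ ≤ _ := by
              gcongr
              exact mul_le_of_le_one_left hlogT hsmall
      _ = _ := by rw [Real.exp_add, Real.exp_log (by linarith)]
  refine ⟨c * (1 + 2 * 3 ^ ((n : ℝ) / 2)), by positivity, fun x R hR => ?_⟩
  calc _ ≤ ∫⁻ z in ball x R, ENNReal.ofReal c * (1 + halfPotential n F x R z) :=
        setLIntegral_mono' measurableSet_ball (hpt x R hR)
    _ ≤ ENNReal.ofReal c * (volume (ball x R) +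
        ENNReal.ofReal (2 * 3 ^ ((n : ℝ) / 2)) * volume (ball x R)) := by
        rw [lintegral_const_mul' _ _ ENNReal.ofReal_ne_top, lintegral_add_left measurable_const]
        gcongr
        · simp
        · exact setLIntegral_halfPotential_le hn hFm hF x hR
    _ = _ := by
        rw [ENNReal.ofReal_mul hc0.le, ENNReal.ofReal_add zero_le_one (by positivity),
          ENNReal.ofReal_one]
        ring

end ExponentialIntegrability

section Chains

lemma setLIntegral_Ico_rpow_half_le (s : ℝ) {R : ℝ} (hR : 0 < R) :
    ∫⁻ t in Ico 0 R, ENNReal.ofReal ((R / ‖s - t‖) ^ (1 / 2 : ℝ)) ≤ ENNReal.ofReal (5 * R) := by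
  have hsub : Ico 0 R ⊆ {t : ℝ | ‖s - t‖ ∈ Iio (1 * R)} ∪
      (Ico 0 R ∩ {t : ℝ | ‖s - t‖ ∈ Ici R}) := by
    intro t ht
    rcases lt_or_ge ‖s - t‖ R with h | h
    · exact Or.inl (show ‖s - t‖ < 1 * R by linarith)
    · exact Or.inr ⟨ht, h⟩
  have hnear : ∫⁻ t in {t : ℝ | ‖s - t‖ ∈ Iio (1 * R)},
      ENNReal.ofReal ((R / ‖s - t‖) ^ (1 / 2 : ℝ)) ≤ ENNReal.ofReal (4 * R) := by
    calc _ = ∫⁻ t in {t : ℝ | ‖s - t‖ ∈ Iio (1 * R)}, ENNReal.ofReal R *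
          ENNReal.ofReal (‖s - t‖ ^ (-((1 : ℕ) : ℝ)) * (‖s - t‖ / R) ^ (1 / 2 : ℝ)) := by
          refine lintegral_congr fun t => ?_
          rw [← ENNReal.ofReal_mul hR.le]
          congr 1
          rcases (norm_nonneg (s - t)).eq_or_lt with h0 | h0
          · simp [← h0]
          · have e1 : R = R ^ (1 / 2 : ℝ) * R ^ (1 / 2 : ℝ) := by
              rw [← Real.rpow_add hR]; norm_num
            have e2 : ‖s - t‖ = ‖s - t‖ ^ (1 / 2 : ℝ) * ‖s - t‖ ^ (1 / 2 : ℝ) := by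
              rw [← Real.rpow_add h0]; norm_num
            rw [Real.div_rpow hR.le h0.le, Real.div_rpow h0.le hR.le, Nat.cast_one,
              Real.rpow_neg_one]
            have h1 := Real.rpow_pos_of_pos h0 (1 / 2)
            have h2 := Real.rpow_pos_of_pos hR (1 / 2)
            generalize ‖s - t‖ ^ (1 / 2 : ℝ) = a at *
            generalize R ^ (1 / 2 : ℝ) = b at *
            rw [e2]
            subst e1
            field_simp
      _ ≤ _ := by
          rw [lintegral_const_mul' _ _ ENNReal.ofReal_ne_top, mul_comm 4 R,
            ENNReal.ofReal_mul hR.le]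
          gcongr
          refine (setLIntegral_rpow_neg_mul_rpow_le (by simp) s (by norm_num) hR one_pos).trans ?_
          refine ENNReal.ofReal_le_ofReal ?_
          simp [Real.volume_real_ball]
          norm_num
  have hfar : ∫⁻ t in Ico 0 R ∩ {t : ℝ | ‖s - t‖ ∈ Ici R},
      ENNReal.ofReal ((R / ‖s - t‖) ^ (1 / 2 : ℝ)) ≤ ENNReal.ofReal R := by
    calc _ ≤ ∫⁻ _ in Ico 0 R ∩ {t : ℝ | ‖s - t‖ ∈ Ici R}, (1 : ℝ≥0∞) := by
          refine setLIntegral_mono' (measurableSet_Ico.inter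
            (measurableSet_norm_sub_mem s measurableSet_Ici)) ?_
          rintro t ⟨-, ht : R ≤ ‖s - t‖⟩
          rw [ENNReal.ofReal_le_one]
          exact Real.rpow_le_one (by positivity) ((div_le_one (hR.trans_le ht)).2 ht) (by norm_num)
      _ ≤ ∫⁻ _ in Ico 0 R, (1 : ℝ≥0∞) := lintegral_mono_set inter_subset_left
      _ = _ := by simp
  calc _ ≤ _ := lintegral_mono_set hsub
    _ ≤ _ := lintegral_union_le _ _ _
    _ ≤ _ := add_le_add hnear hfar
    _ = _ := by
      rw [← ENNReal.ofReal_add (by positivity) hR.le]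
      ring_nf

variable {E : Type*} [NormedAddCommGroup E] [MeasureSpace E] [NormedSpace ℝ E]
  [FiniteDimensional ℝ E] [Nontrivial E] [BorelSpace E] [(volume : Measure E).IsAddHaarMeasure]

lemma volume_mul_rpow_half_le {A : Set ℝ} (hA : MeasurableSet A) {s r R : ℝ} (hR : 0 ≤ R)
    (h : ∀ t ∈ A, ‖s - t‖ ≤ 2 * r) :
    volume A * ENNReal.ofReal ((R / r) ^ (1 / 2 : ℝ)) ≤
      ENNReal.ofReal (2 ^ (1 / 2 : ℝ)) *
        ∫⁻ t in A, ENNReal.ofReal ((R / ‖s - t‖) ^ (1 / 2 : ℝ)) := by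
  rw [← lintegral_const_mul' _ _ ENNReal.ofReal_ne_top, mul_comm, ← setLIntegral_const]
  refine setLIntegral_mono_ae' hA ?_
  filter_upwards [(measure_eq_zero_iff_ae_notMem.1 (measure_singleton s) :
    ∀ᵐ t : ℝ ∂volume, t ∉ ({s} : Set ℝ))] with t hts htA
  have h0 : 0 < ‖s - t‖ := norm_pos_iff.2 (sub_ne_zero.2 fun H => hts (by simp [H]))
  have h1 := h t htA
  have hr : 0 < r := by linarith
  rw [← ENNReal.ofReal_mul (by positivity), ← Real.mul_rpow (by norm_num) (by positivity)]
  refine ENNReal.ofReal_le_ofReal (Real.rpow_le_rpow (by positivity) ?_ (by norm_num))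
  rw [mul_div_assoc', div_le_div_iff₀ hr h0]
  nlinarith

/-- A family of near potentials, weighted by the lengths of disjoint intervals of radii, has
bounded average. -/
lemma sum_volume_mul_nearPotential_le {n : ℕ} (hn : Module.finrank ℝ E = n) {α η R : ℝ}
    (hα : 0 < α) (hαn : α < n) {h : E → ℝ} (hh : Measurable h) (hη : 0 < η)
    (hF : ∫⁻ y, ENNReal.ofReal (|h y| ^ ((n : ℝ) / α) / η ^ ((n : ℝ) / α)) ≤ 1)
    (hR : 0 < R) (x : E) (N : ℕ) {A : ℕ → Set ℝ} (hA : ∀ i, MeasurableSet (A i))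
    (hdisj : Pairwise (Function.onFun Disjoint A)) (hAR : ∀ i, A i ⊆ Ico 0 R) (z : ℕ → E)
    (ρ : ℕ → ℝ)
    (hz : ∀ i, ∀ t ∈ A i, ‖z i - x‖ ≤ R ∧ |t - ‖z i - x‖| ≤ ρ i) :
    ∑ i ∈ Finset.range N, volume (A i) * nearPotential (α - n) h (z i) (ρ i) x (4 * R) ≤
      ENNReal.ofReal (η * (2 ^ (1 / 2 : ℝ) * 5 + n * volume.real (ball (0 : E) 1) *
        (5 ^ (1 / 2 * (α / (n - α))) / (1 / 2 * (α / (n - α))))) * R) := by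
  have hd : 0 < (n : ℝ) - α := sub_pos.2 hαn
  set θ := 1 / 2 * (α / (n - α)) with hθ
  have hθ0 : 0 < θ := by positivity
  set b := n * volume.real (ball (0 : E) 1) * (5 ^ θ / θ) with hb
  have hb0 : 0 ≤ b := by positivity
  set F : E → ℝ≥0∞ := fun y => ENNReal.ofReal (|h y| ^ ((n : ℝ) / α) / η ^ ((n : ℝ) / α))
    with hFdef
  have hFm : Measurable F := by fun_prop
  set Ψ : E → Set ℝ → ℝ≥0∞ := fun y A =>
    ∫⁻ t in A, ENNReal.ofReal ((R / ‖‖y - x‖ - t‖) ^ (1 / 2 : ℝ)) with hΨ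
  have hΨm : ∀ i, Measurable fun y => Ψ y (A i) := by
    intro i
    have : Measurable fun p : E × ℝ =>
      ENNReal.ofReal ((R / ‖‖p.1 - x‖ - p.2‖) ^ (1 / 2 : ℝ)) := by fun_prop
    exact this.lintegral_prod_right'
  have hterm : ∀ i, volume (A i) * nearPotential (α - n) h (z i) (ρ i) x (4 * R) ≤
      ENNReal.ofReal η * (ENNReal.ofReal (2 ^ (1 / 2 : ℝ)) * (∫⁻ y, F y * Ψ y (A i)) +
        ENNReal.ofReal b * volume (A i)) := by
    intro i
    rcases (A i).eq_empty_or_nonempty with h0 | ⟨t₀, ht₀⟩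
    · simp [h0]
    have hzR := (hz i t₀ ht₀).1
    have hAtop : volume (A i) ≠ ⊤ := ne_top_of_le_ne_top (by simp) (measure_mono (hAR i))
    set G := {y : E | ‖z i - y‖ ∈ Ici (ρ i)} ∩ ball x (4 * R) with hG
    have hGm : MeasurableSet G :=
      (measurableSet_norm_sub_mem (z i) measurableSet_Ici).inter measurableSet_ball
    have hGsub : G ⊆ {y : E | ‖z i - y‖ ∈ Iio (5 * R)} := by
      rintro y ⟨-, hy⟩
      rw [mem_ball', dist_eq_norm] at hy
      have := norm_sub_le_norm_sub_add_norm_sub (z i) x y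
      show ‖z i - y‖ < 5 * R
      linarith
    calc _ ≤ volume (A i) * ∫⁻ y in G, ENNReal.ofReal η *
          (F y * ENNReal.ofReal ((R / ‖z i - y‖) ^ (1 / 2 : ℝ)) +
            ENNReal.ofReal (‖z i - y‖ ^ (-(n : ℝ)) * (‖z i - y‖ / R) ^ θ)) := by
          unfold nearPotential
          gcongr with y
          exact ofReal_mul_rieszKernel_le (1 / 2) hα hαn (abs_nonneg (h y)) hη
            (norm_nonneg (z i - y)) hR
      _ ≤ ENNReal.ofReal η *
          ((∫⁻ y in G, F y * (volume (A i) * ENNReal.ofReal ((R / ‖z i - y‖) ^ (1 / 2 : ℝ)))) +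
          ENNReal.ofReal b * volume (A i)) := by
          rw [lintegral_const_mul' _ _ ENNReal.ofReal_ne_top, lintegral_add_left (by fun_prop),
            mul_left_comm, mul_add, ← lintegral_const_mul' _ _ hAtop, mul_comm (volume (A i))]
          gcongr ENNReal.ofReal η * (?_ + ?_ * volume (A i))
          · exact (lintegral_congr fun y => mul_left_comm _ _ _).le
          · exact (lintegral_mono_set hGsub).trans
              (setLIntegral_rpow_neg_mul_rpow_le hn (z i) hθ0 hR (by norm_num))
      _ ≤ _ := by
          rw [← lintegral_const_mul' _ _ ENNReal.ofReal_ne_top]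
          gcongr ENNReal.ofReal η * (?_ + _)
          refine (setLIntegral_mono' hGm fun y hy => ?_).trans (setLIntegral_le_lintegral G _)
          rw [mul_left_comm (ENNReal.ofReal (2 ^ (1 / 2 : ℝ)))]
          gcongr F y * ?_
          refine volume_mul_rpow_half_le (hA i) hR.le fun t ht => ?_
          have h1 : ρ i ≤ ‖z i - y‖ := hy.1
          have h2 := (hz i t ht).2
          have h3 : |‖z i - x‖ - ‖y - x‖| ≤ ‖z i - y‖ := by
            refine (abs_norm_sub_norm_le _ _).trans ?_
            simp
          rw [Real.norm_eq_abs, abs_le]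
          rw [abs_le] at h2 h3
          constructor <;> linarith
  have hsum : ∀ y, ∑ i ∈ Finset.range N, Ψ y (A i) ≤ ENNReal.ofReal (5 * R) := by
    intro y
    rw [hΨ]
    dsimp only
    rw [← lintegral_biUnion_finset (fun i _ j _ hij => hdisj hij) (fun i _ => hA i)]
    exact (lintegral_mono_set (iUnion₂_subset fun i _ => hAR i)).trans
      (setLIntegral_Ico_rpow_half_le _ hR)
  have hsumA : ∑ i ∈ Finset.range N, volume (A i) ≤ ENNReal.ofReal R := by
    rw [← measure_biUnion_finset (fun i _ j _ hij => hdisj hij) (fun i _ => hA i)]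
    exact (measure_mono (iUnion₂_subset fun i _ => hAR i)).trans (by simp)
  calc _ ≤ _ := Finset.sum_le_sum fun i _ => hterm i
    _ = ENNReal.ofReal η * (ENNReal.ofReal (2 ^ (1 / 2 : ℝ)) *
          (∫⁻ y, F y * ∑ i ∈ Finset.range N, Ψ y (A i)) +
        ENNReal.ofReal b * ∑ i ∈ Finset.range N, volume (A i)) := by
        simp_rw [Finset.mul_sum]
        rw [lintegral_finsetSum (f := fun i y => F y * Ψ y (A i)) _
          fun i _ => hFm.mul (hΨm i), ← Finset.mul_sum, Finset.sum_add_distrib, Finset.mul_sum]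
    _ ≤ ENNReal.ofReal η * (ENNReal.ofReal (2 ^ (1 / 2 : ℝ)) * (1 * ENNReal.ofReal (5 * R)) +
          ENNReal.ofReal b * ENNReal.ofReal R) := by
        gcongr
        calc _ ≤ ∫⁻ y, F y * ENNReal.ofReal (5 * R) := by
              gcongr with y
              exact hsum y
          _ ≤ _ := by
              rw [lintegral_mul_const _ hFm]
              gcongr
    _ = _ := by
        rw [one_mul, ← ENNReal.ofReal_mul (by positivity), ← ENNReal.ofReal_mul hb0,
          ← ENNReal.ofReal_add (by positivity) (by positivity), ← ENNReal.ofReal_mul hη.le]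
        ring_nf

omit [FiniteDimensional ℝ E] [Nontrivial E] [(volume : Measure E).IsAddHaarMeasure]
  [NormedSpace ℝ E] [BorelSpace E] in
lemma nearPotential_ne_top {γ : ℝ} {h : E → ℝ} {z : E}
    (hconv : Integrable fun y => h y * ‖z - y‖ ^ γ) (ρ : ℝ) (x : E) (r : ℝ) :
    nearPotential γ h z ρ x r ≠ ⊤ := by
  refine ne_top_of_le_ne_top hconv.2.ne ((setLIntegral_le_lintegral _ _).trans ?_)
  refine (lintegral_congr fun y => ?_).le
  rw [← ofReal_norm, Real.norm_eq_abs, abs_mul, abs_of_nonneg (by positivity : 0 ≤ ‖z - y‖ ^ γ)]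

omit [FiniteDimensional ℝ E] [Nontrivial E] [(volume : Measure E).IsAddHaarMeasure]
  [NormedSpace ℝ E] [BorelSpace E] [MeasureSpace E] in
/-- The radii between `0` and the distance of the endpoints of a chain are distributed disjointly
among the links of the chain. -/
lemma exists_disjoint_radii_of_chain (s : ℕ → E) (N : ℕ) :
    ∃ A : ℕ → Set ℝ, (∀ i, MeasurableSet (A i)) ∧ Pairwise (Function.onFun Disjoint A) ∧
      (∀ i, A i ⊆ Ico 0 ‖s 0 - s N‖) ∧
      (∀ i, A i ⊆ Ico ‖s i - s 0‖ ‖s (i + 1) - s 0‖) ∧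
      Ico 0 ‖s 0 - s N‖ ⊆ ⋃ i ∈ Finset.range N, A i := by
  set R := ‖s 0 - s N‖ with hR
  set B : ℕ → Set ℝ := fun i => Ico ‖s i - s 0‖ ‖s (i + 1) - s 0‖ ∩ Ico 0 R with hB
  refine ⟨disjointed B, MeasurableSet.disjointed fun i => measurableSet_Ico.inter measurableSet_Ico,
    disjoint_disjointed B, fun i => (disjointed_subset B i).trans inter_subset_right,
    fun i => (disjointed_subset B i).trans inter_subset_left, ?_⟩
  intro t ht
  have hex : ∃ i, t < ‖s i - s 0‖ := ⟨N, by rw [norm_sub_rev]; exact ht.2⟩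
  classical
  have hlt := Nat.find_spec hex
  have hle : Nat.find hex ≤ N := Nat.find_min' hex (by rw [norm_sub_rev]; exact ht.2)
  obtain ⟨i, hi⟩ : ∃ i, Nat.find hex = i + 1 := by
    refine Nat.exists_eq_succ_of_ne_zero fun h0 => ?_
    rw [h0, sub_self, norm_zero] at hlt
    exact absurd ht.1 (not_le.2 hlt)
  have hmin : ‖s i - s 0‖ ≤ t := not_lt.1 (Nat.find_min hex (by omega))
  rw [hi] at hlt hle
  have hmem : t ∈ partialSups B i := le_partialSups B i ⟨⟨hmin, hlt⟩, ht⟩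
  rw [← biUnion_range_succ_disjointed] at hmem
  exact biUnion_subset_biUnion_left (fun j hj => Finset.range_mono hle hj) hmem

/-- Chains are not much shorter than the distance of their endpoints when lengths are weighted by
the exponential of a truncated potential. -/
lemma exists_mul_exp_truncatedPotential_le_sum {n : ℕ} (hn : Module.finrank ℝ E = n)
    {α η κ : ℝ} (hα : 0 < α) (hαn : α < n) {h : E → ℝ} (hh : Measurable h) (hη : 0 < η)
    (hF : ∫⁻ y, ENNReal.ofReal (|h y| ^ ((n : ℝ) / α) / η ^ ((n : ℝ) / α)) ≤ 1)
    (hconv : ∀ z : E, Integrable fun y => h y * ‖z - y‖ ^ (α - n)) (hκ : 0 ≤ κ) :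
    ∃ c : ℝ, 0 < c ∧ ∀ (s : ℕ → E) (N : ℕ), s 0 ≠ s N →
      c * (‖s 0 - s N‖ *
        Real.exp (κ * truncatedPotential (α - n) h (s 0) (2 * ‖s 0 - s N‖))) ≤
      ∑ i ∈ Finset.range N, min ‖s i - s (i + 1)‖ ‖s 0 - s N‖ *
        Real.exp (κ * truncatedPotential (α - n) h (s i)
          (min ‖s i - s (i + 1)‖ ‖s 0 - s N‖)) := by
  have hd : 0 < (n : ℝ) - α := sub_pos.2 hαn
  set a := (2 + (n - α) * 2 ^ ((n : ℝ) - α + 1)) *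
    (η * (1 + n * volume.real (ball (0 : E) 1))) with ha
  have ha0 : 0 ≤ a := by positivity
  set K := η * (2 ^ (1 / 2 : ℝ) * 5 + n * volume.real (ball (0 : E) 1) *
        (5 ^ (1 / 2 * (α / (n - α))) / (1 / 2 * (α / (n - α))))) with hK
  have hK0 : 0 ≤ K := by positivity
  refine ⟨Real.exp (-(κ * (a + K))), Real.exp_pos _, fun s N hne => ?_⟩
  set R := ‖s 0 - s N‖ with hR
  have hR0 : 0 < R := norm_pos_iff.2 (sub_ne_zero.2 hne)
  set x := s 0 with hx
  set ρ : ℕ → ℝ := fun i => min ‖s i - s (i + 1)‖ R with hρ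
  have hρ0 : ∀ i, 0 ≤ ρ i := fun i => le_min (norm_nonneg _) hR0.le
  obtain ⟨A, hA, hdisj, hAR, hAI, hcov⟩ := exists_disjoint_radii_of_chain s N
  have hz : ∀ i, ∀ t ∈ A i, ‖s i - x‖ ≤ R ∧ |t - ‖s i - x‖| ≤ ρ i := by
    intro i t ht
    have h1 := hAI i ht
    have h2 := hAR i ht
    have h3 : ‖s (i + 1) - x‖ ≤ ‖s i - x‖ + ‖s i - s (i + 1)‖ := by
      have := norm_sub_le_norm_sub_add_norm_sub (s (i + 1)) (s i) x
      rw [norm_sub_rev (s (i + 1)) (s i)] at this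
      linarith
    have h4 := norm_nonneg (s i - x)
    refine ⟨h1.1.trans h2.2.le, ?_⟩
    rw [abs_of_nonneg (by linarith [h1.1])]
    exact le_min (by linarith [h1.2]) (by linarith [h2.2])
  have hAtop : ∀ i, volume (A i) ≠ ⊤ := fun i =>
    ne_top_of_le_ne_top (by simp) (measure_mono (hAR i))
  have hAρ : ∀ i, volume.real (A i) ≤ ρ i := by
    intro i
    refine le_min ?_ ?_
    · refine (measureReal_mono (hAI i) (by simp)).trans ?_
      rw [Real.volume_real_Ico]
      refine max_le ?_ (norm_nonneg _)
      have := norm_sub_le_norm_sub_add_norm_sub (s (i + 1)) (s i) (s 0)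
      rw [norm_sub_rev (s (i + 1)) (s i)] at this
      linarith
    · refine (measureReal_mono (hAR i) (by simp)).trans ?_
      rw [Real.volume_real_Ico]
      exact max_le (by simp [hR, hx]) hR0.le
  have hsumA : R ≤ ∑ i ∈ Finset.range N, volume.real (A i) := by
    calc R = volume.real (Ico 0 R) := by simp [hR0.le]
      _ ≤ volume.real (⋃ i ∈ Finset.range N, A i) :=
        measureReal_mono hcov (ne_top_of_le_ne_top (by simp : volume (Ico 0 R) ≠ ⊤)
          (measure_mono (iUnion₂_subset fun i _ => hAR i)))
      _ ≤ _ := measureReal_biUnion_finset_le _ _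
  set J : ℕ → ℝ := fun i => (nearPotential (α - n) h (s i) (ρ i) x (4 * R)).toReal with hJ
  have hJsum : ∑ i ∈ Finset.range N, volume.real (A i) * J i ≤ K * R := by
    have h1 := sum_volume_mul_nearPotential_le hn hα hαn hh hη hF hR0 x N hA hdisj hAR s ρ hz
    have h2 := ENNReal.toReal_mono ENNReal.ofReal_ne_top h1
    rw [ENNReal.toReal_ofReal (by positivity), ENNReal.toReal_sum fun i _ =>
      ENNReal.mul_ne_top (hAtop i) (nearPotential_ne_top (hconv _) _ _ _)] at h2
    simp only [ENNReal.toReal_mul] at h2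
    exact h2
  set V := truncatedPotential (α - n) h x (2 * R) with hV
  have hterm : ∀ i, Real.exp (κ * (V - a) - κ * K) *
      (volume.real (A i) * (1 + κ * K) - κ * (volume.real (A i) * J i)) ≤
      ρ i * Real.exp (κ * truncatedPotential (α - n) h (s i) (ρ i)) := by
    intro i
    rcases (A i).eq_empty_or_nonempty with h0 | ⟨t, ht⟩
    · simpa [h0] using mul_nonneg (hρ0 i) (Real.exp_pos _).le
    have h1 := ofReal_abs_truncatedPotential_sub_le hn hα hαn hh hη hF hconv (x := x) (z := s i)
      (S := 2 * R) (ρ := ρ i) (by positivity) (by linarith [(hz i t ht).1])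
      ((min_le_right _ _).trans (by linarith))
    rw [show 2 * (2 * R) = 4 * R by ring,
      ← ENNReal.ofReal_toReal (nearPotential_ne_top (hconv (s i)) (ρ i) x (4 * R)),
      ← ENNReal.ofReal_add ha0 ENNReal.toReal_nonneg,
      ENNReal.ofReal_le_ofReal_iff (by positivity)] at h1
    have h2 : V - a - J i ≤ truncatedPotential (α - n) h (s i) (ρ i) := by
      have := (abs_le.1 h1).1
      linarith
    have h3 : 1 + κ * K - κ * J i ≤ Real.exp (κ * K - κ * J i) := by
      linarith [Real.add_one_le_exp (κ * K - κ * J i)]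
    calc _ = volume.real (A i) *
          (Real.exp (κ * (V - a) - κ * K) * (1 + κ * K - κ * J i)) := by ring
      _ ≤ ρ i * Real.exp (κ * truncatedPotential (α - n) h (s i) (ρ i)) := by
        refine (mul_le_mul_of_nonneg_left ?_ measureReal_nonneg).trans
          (mul_le_mul_of_nonneg_right (hAρ i) (Real.exp_pos _).le)
        calc _ ≤ Real.exp (κ * (V - a) - κ * K) * Real.exp (κ * K - κ * J i) := by gcongr
          _ = Real.exp (κ * (V - a - J i)) := by rw [← Real.exp_add]; ring_nf
          _ ≤ _ := by gcongr
  calc _ = Real.exp (κ * (V - a) - κ * K) * (R * (1 + κ * K) - κ * (K * R)) := by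
        rw [mul_left_comm, ← Real.exp_add]
        ring_nf
    _ ≤ Real.exp (κ * (V - a) - κ * K) * ((∑ i ∈ Finset.range N, volume.real (A i)) * (1 + κ * K) -
        κ * ∑ i ∈ Finset.range N, volume.real (A i) * J i) := by gcongr
    _ = ∑ i ∈ Finset.range N, Real.exp (κ * (V - a) - κ * K) *
      (volume.real (A i) * (1 + κ * K) - κ * (volume.real (A i) * J i)) := by
        rw [← Finset.mul_sum, Finset.sum_sub_distrib, Finset.sum_mul, Finset.mul_sum]
    _ ≤ _ := Finset.sum_le_sum fun i _ => hterm i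

end Chains

section ChainMetric

/-- A symmetric function which satisfies a coarse triangle inequality along all chains is
comparable to a metric. -/
lemma exists_comparable_metric {X : Type*} {q : X → X → NNReal} (hself : ∀ x, q x x = 0)
    (hcomm : ∀ x y, q x y = q y x) (hpos : ∀ x y, q x y = 0 → x = y) {c : ℝ} (hc : 0 < c)
    (hchain : ∀ (s : ℕ → X) (N : ℕ), s 0 ≠ s N →
      c * q (s 0) (s N) ≤ ∑ i ∈ Finset.range N, (q (s i) (s (i + 1)) : ℝ)) :
    ∃ d : X → X → ℝ, (∀ x y, 0 ≤ d x y) ∧ (∀ x y, d x y = d y x) ∧ (∀ x y, d x y = 0 ↔ x = y) ∧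
      (∀ x y z, d x z ≤ d x y + d y z) ∧ ∀ x y, c * q x y ≤ d x y ∧ d x y ≤ q x y := by
  have hlist : ∀ (l : List X) (x y : X), ∃ (s : ℕ → X) (N : ℕ), s 0 = x ∧ s N = y ∧
      ∑ i ∈ Finset.range N, q (s i) (s (i + 1)) = (List.zipWith q (x :: l) (l ++ [y])).sum := by
    intro l
    induction l with
    | nil => exact fun x y => ⟨fun i => if i = 0 then x else y, 1, by simp, by simp, by simp⟩
    | cons a l ih =>
      intro x y
      obtain ⟨s, N, h0, hN, hs⟩ := ih a y
      refine ⟨fun i => Nat.casesOn i x s, N + 1, rfl, hN, ?_⟩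
      rw [Finset.sum_range_succ']
      rw [List.cons_append, List.zipWith_cons_cons, List.sum_cons, ← hs, add_comm, ← h0]
      rfl
  let := PseudoMetricSpace.ofPreNNDist q hself hcomm
  have hle : ∀ x y : X, dist x y ≤ q x y := PseudoMetricSpace.dist_ofPreNNDist_le q hself hcomm
  have hge : ∀ x y : X, c * q x y ≤ dist x y := by
    intro x y
    rcases eq_or_ne x y with rfl | hxy
    · simp [hself]
    rw [PseudoMetricSpace.dist_ofPreNNDist q hself hcomm, ← Real.coe_toNNReal c hc.le,
      ← NNReal.coe_mul, NNReal.coe_le_coe]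
    refine le_ciInf fun l => ?_
    obtain ⟨s, N, rfl, rfl, hs⟩ := hlist l x y
    rw [← hs, ← NNReal.coe_le_coe]
    push_cast
    rw [Real.coe_toNNReal c hc.le]
    exact hchain s N hxy
  refine ⟨fun x y => dist x y, fun x y => dist_nonneg, dist_comm, fun x y => ⟨fun h => ?_, ?_⟩,
    dist_triangle, fun x y => ⟨hge x y, hle x y⟩⟩
  · have h1 := hge x y
    rw [show dist x y = 0 from h] at h1
    exact hpos x y (NNReal.coe_eq_zero.1 (le_antisymm (nonpos_of_mul_nonpos_right h1 hc)
      (q x y).2))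
  · rintro rfl
    exact dist_self x

end ChainMetric

section Splitting

variable {E : Type*} [NormedAddCommGroup E] [MeasureSpace E] [BorelSpace E]

/-- A function in `L^p` is small in `L^p` off a bounded set on which it is bounded. -/
lemma exists_lintegral_indicator_compl_le {f : E → ℝ} (hf : Measurable f) {p δ : ℝ} (hp : 0 < p)
    (hδ : 0 < δ) (hfint : ∫⁻ x, ENNReal.ofReal (|f x| ^ p) < ⊤) :
    ∃ N : ℕ, ∫⁻ x, ENNReal.ofReal (|{y | |f y| ≤ N ∧ ‖y‖ ≤ N}ᶜ.indicator f x| ^ p) ≤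
      ENNReal.ofReal δ := by
  have hm : ∀ N : ℕ, MeasurableSet {y | |f y| ≤ N ∧ ‖y‖ ≤ N} := fun N =>
    (measurableSet_le hf.abs measurable_const).inter
      (measurableSet_le measurable_norm measurable_const)
  have hlim := tendsto_lintegral_of_dominated_convergence (μ := (volume : Measure E))
    (F := fun (N : ℕ) x => ENNReal.ofReal (|{y | |f y| ≤ N ∧ ‖y‖ ≤ N}ᶜ.indicator f x| ^ p))
    (f := fun _ => 0) (fun x => ENNReal.ofReal (|f x| ^ p))
    (fun N => (((hf.indicator (hm N).compl).abs).pow_const p).ennreal_ofReal) ?_ hfint.ne ?_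
  · rw [lintegral_zero] at hlim
    have h0 : (0 : ℝ≥0∞) < ENNReal.ofReal δ := ENNReal.ofReal_pos.2 hδ
    obtain ⟨N, hN⟩ := (hlim.eventually_lt_const h0).exists
    exact ⟨N, hN.le⟩
  · refine fun N => ae_of_all _ fun x => ENNReal.ofReal_le_ofReal ?_
    refine Real.rpow_le_rpow (abs_nonneg _) ?_ hp.le
    simpa only [Real.norm_eq_abs] using norm_indicator_le_norm_self f x
  · refine ae_of_all _ fun x => tendsto_const_nhds.congr' ?_
    obtain ⟨N, hN⟩ := exists_nat_ge (max |f x| ‖x‖)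
    filter_upwards [Filter.eventually_ge_atTop N] with M hM
    have hMN : max |f x| ‖x‖ ≤ M := hN.trans (by exact_mod_cast hM)
    rw [indicator_of_notMem, abs_zero, Real.zero_rpow hp.ne', ENNReal.ofReal_zero]
    exact fun h => h ⟨(le_max_left _ _).trans hMN, (le_max_right _ _).trans hMN⟩

variable [NormedSpace ℝ E] [FiniteDimensional ℝ E] [Nontrivial E]
  [(volume : Measure E).IsAddHaarMeasure]

/-- The Riesz-type potential of a bounded function supported in a bounded set is bounded. -/
lemma exists_abs_integral_mul_rpow_le {n : ℕ} (hn : Module.finrank ℝ E = n) {α : ℝ}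
    (hα : 0 < α) (hαn : α < n) {N : ℝ} (hN : 0 ≤ N) {g : E → ℝ} (hg : ∀ y, |g y| ≤ N)
    (hg0 : ∀ y, N < ‖y‖ → g y = 0) :
    ∃ M : ℝ, 0 ≤ M ∧ ∀ x, |∫ y, g y * ‖x - y‖ ^ (α - n)| ≤ M := by
  set a := n * volume.real (ball (0 : E) 1) * (1 ^ α / α) with ha
  have ha0 : 0 ≤ a := by positivity
  refine ⟨N * (a + volume.real (closedBall (0 : E) N)), by positivity, fun x => ?_⟩
  have hpt : ∀ y, ‖g y * ‖x - y‖ ^ (α - n)‖ₑ ≤ ENNReal.ofReal N *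
      ({y | ‖x - y‖ ∈ Iio (1 * 1)}.indicator
        (fun y => ENNReal.ofReal (‖x - y‖ ^ (-(n : ℝ)) * (‖x - y‖ / 1) ^ α)) y +
        (closedBall (0 : E) N).indicator (fun _ => 1) y) := by
    intro y
    rw [← ofReal_norm, Real.norm_eq_abs, abs_mul, abs_of_nonneg (by positivity :
      0 ≤ ‖x - y‖ ^ (α - n)), ENNReal.ofReal_mul (abs_nonneg _)]
    rcases lt_or_ge N ‖y‖ with hy | hy
    · simp [hg0 y hy]
    refine mul_le_mul' (ENNReal.ofReal_le_ofReal (hg y)) ?_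
    rcases lt_or_ge ‖x - y‖ 1 with h1 | h1
    · have hmem : y ∈ {y | ‖x - y‖ ∈ Iio (1 * 1 : ℝ)} := by simpa using h1
      rw [indicator_of_mem hmem]
      refine le_add_right (ENNReal.ofReal_le_ofReal ?_)
      rcases (norm_nonneg (x - y)).eq_or_lt with h0 | h0
      · rw [← h0, Real.zero_rpow (by linarith)]
        positivity
      · rw [div_one, ← Real.rpow_add h0, neg_add_eq_sub]
    · rw [indicator_of_mem (mem_closedBall_zero_iff.2 hy)]
      refine le_add_left (ENNReal.ofReal_le_one.2 ?_)
      exact Real.rpow_le_one_of_one_le_of_nonpos h1 (by linarith)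
  have h : ‖∫ y, g y * ‖x - y‖ ^ (α - n)‖ₑ ≤
      ENNReal.ofReal (N * (a + volume.real (closedBall (0 : E) N))) := by
    calc _ ≤ _ := enorm_integral_le_lintegral_enorm _
      _ ≤ _ := lintegral_mono hpt
      _ ≤ ENNReal.ofReal N * (ENNReal.ofReal a + volume (closedBall (0 : E) N)) := by
        rw [lintegral_const_mul' _ _ ENNReal.ofReal_ne_top,
          lintegral_add_right _ (measurable_const.indicator measurableSet_closedBall),
          lintegral_indicator (measurableSet_norm_sub_mem x measurableSet_Iio),
          lintegral_indicator measurableSet_closedBall, setLIntegral_one]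
        gcongr ENNReal.ofReal N * (?_ + _)
        exact setLIntegral_rpow_neg_mul_rpow_le hn x hα one_pos one_pos
      _ = _ := by
        rw [ENNReal.ofReal_mul hN, ENNReal.ofReal_add ha0 measureReal_nonneg,
          ofReal_measureReal measure_closedBall_lt_top.ne]
  rwa [← ofReal_norm, Real.norm_eq_abs, ENNReal.ofReal_le_ofReal_iff (by positivity)] at h

/-- A potential in the critical range is, up to a bounded function, the potential of a function
of small norm. -/
lemma exists_small_potential {n : ℕ} (hn : Module.finrank ℝ E = n) {α : ℝ}
    (hα : 0 < α) (hαn : α < n) {f : E → ℝ} (hf : Measurable f)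
    (hfint : ∫⁻ x, ENNReal.ofReal (|f x| ^ ((n : ℝ) / α)) < ⊤)
    (hconv : ∀ z : E, Integrable fun y => f y * ‖z - y‖ ^ (α - n)) {η : ℝ} (hη : 0 < η) :
    ∃ h : E → ℝ, Measurable h ∧
      ∫⁻ y, ENNReal.ofReal (|h y| ^ ((n : ℝ) / α) / η ^ ((n : ℝ) / α)) ≤ 1 ∧
      (∀ z : E, Integrable fun y => h y * ‖z - y‖ ^ (α - n)) ∧
      ∃ M : ℝ, 0 ≤ M ∧ ∀ z, |(∫ y, f y * ‖z - y‖ ^ (α - n)) -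
        truncatedPotential (α - n) h z 0| ≤ M := by
  have hp : 0 < (n : ℝ) / α := div_pos (hα.trans hαn) hα
  have hδ : 0 < η ^ ((n : ℝ) / α) := Real.rpow_pos_of_pos hη _
  obtain ⟨N, hN⟩ := exists_lintegral_indicator_compl_le hf hp hδ hfint
  set S := {y | |f y| ≤ N ∧ ‖y‖ ≤ N} with hS
  have hSm : MeasurableSet S :=
    (measurableSet_le hf.abs measurable_const).inter
      (measurableSet_le measurable_norm measurable_const)
  have hmul : ∀ (T : Set E) (z : E), (fun y => T.indicator f y * ‖z - y‖ ^ (α - n)) =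
      T.indicator fun y => f y * ‖z - y‖ ^ (α - n) := by
    intro T z
    ext y
    by_cases hy : y ∈ T <;> simp [hy]
  have hint : ∀ {T : Set E}, MeasurableSet T → ∀ z : E,
      Integrable fun y => T.indicator f y * ‖z - y‖ ^ (α - n) := by
    intro T hT z
    rw [hmul]
    exact (hconv z).indicator hT
  obtain ⟨M, hM0, hM⟩ := exists_abs_integral_mul_rpow_le hn hα hαn (N := N) (by positivity)
    (g := S.indicator f) (fun y => by
      by_cases hy : y ∈ S
      · rw [indicator_of_mem hy]
        exact hy.1
      · simp [hy])
    (fun y hy => indicator_of_notMem (fun H => hy.not_ge H.2) f)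
  refine ⟨Sᶜ.indicator f, hf.indicator hSm.compl, ?_, hint hSm.compl, M, hM0, fun z => ?_⟩
  · simp_rw [ENNReal.ofReal_div_of_pos hδ, ENNReal.div_eq_inv_mul]
    rw [lintegral_const_mul' _ _ (by simpa using hδ), ← ENNReal.div_eq_inv_mul]
    exact ENNReal.div_le_of_le_mul (by rwa [one_mul])
  · have huniv : {y : E | ‖z - y‖ ∈ Ici (0 : ℝ)} = univ := by
      ext y
      simp
    rw [truncatedPotential, huniv, setIntegral_univ, ← integral_sub (hconv z) (hint hSm.compl z)]
    convert hM z using 3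
    ext y
    by_cases hy : y ∈ S <;> simp [hy]

end Splitting

section Weights

section Averages

variable {E : Type*} [MeasureSpace E] {n : ℕ} {u : E → ℝ} {C t : ℝ} {B : Set E}

lemma setLIntegral_exp_le
    (h : ∫⁻ z in B, ENNReal.ofReal (Real.exp (2 * n * |u z - t|)) ≤ ENNReal.ofReal C * volume B)
    {k : ℝ} (hk : 0 ≤ k) (hk2 : k ≤ 2 * n) :
    ∫⁻ z in B, ENNReal.ofReal (Real.exp (k * u z)) ≤
      ENNReal.ofReal (C * Real.exp (k * t)) * volume B := by
  calc _ ≤ ∫⁻ z in B, ENNReal.ofReal (Real.exp (k * t)) *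
        ENNReal.ofReal (Real.exp (2 * n * |u z - t|)) := by
        refine lintegral_mono fun z => ?_
        rw [← ENNReal.ofReal_mul (Real.exp_pos _).le, ← Real.exp_add]
        refine ENNReal.ofReal_le_ofReal (Real.exp_le_exp.2 ?_)
        have h1 := mul_le_mul_of_nonneg_left (le_abs_self (u z - t)) hk
        have h2 := mul_le_mul_of_nonneg_right hk2 (abs_nonneg (u z - t))
        linarith
    _ ≤ _ := by
        rw [lintegral_const_mul' _ _ ENNReal.ofReal_ne_top, mul_comm C,
          ENNReal.ofReal_mul (Real.exp_pos _).le, mul_assoc]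
        gcongr

lemma ofReal_exp_mul_volume_le (hu : Measurable u) (hC : 0 < C) (hB : volume B ≠ ⊤)
    (h : ∫⁻ z in B, ENNReal.ofReal (Real.exp (2 * n * |u z - t|)) ≤ ENNReal.ofReal C * volume B) :
    ENNReal.ofReal (Real.exp (n * t)) * volume B ≤
      ENNReal.ofReal C * ∫⁻ z in B, ENNReal.ofReal (Real.exp (n * u z)) := by
  have h1 : ∀ z, ENNReal.ofReal (2 * Real.exp (n * t)) ≤
      ENNReal.ofReal (C⁻¹ * Real.exp (n * t)) * ENNReal.ofReal (Real.exp (2 * n * |u z - t|)) +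
        ENNReal.ofReal C * ENNReal.ofReal (Real.exp (n * u z)) := by
    intro z
    rw [← ENNReal.ofReal_mul (by positivity), ← ENNReal.ofReal_mul hC.le,
      ← ENNReal.ofReal_add (by positivity) (by positivity)]
    refine ENNReal.ofReal_le_ofReal ?_
    set a := Real.exp (n * (u z - t)) with ha
    have ha0 : 0 < a := Real.exp_pos _
    have h2 : a⁻¹ ≤ Real.exp (2 * n * |u z - t|) := by
      rw [ha, ← Real.exp_neg, Real.exp_le_exp]
      have h3 : (0 : ℝ) ≤ n * |u z - t| := by positivity
      have h4 := mul_le_mul_of_nonneg_left (neg_abs_le (u z - t)) (Nat.cast_nonneg n : (0 : ℝ) ≤ n)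
      linarith
    have h5 : Real.exp (n * u z) = Real.exp (n * t) * a := by
      rw [ha, ← Real.exp_add]
      ring_nf
    have h6 : 2 ≤ C⁻¹ * a⁻¹ + C * a := by
      have h7 : 0 < C * a := by positivity
      rw [← mul_inv]
      have h8 : (C * a)⁻¹ * (C * a) = 1 := inv_mul_cancel₀ h7.ne'
      have h9 : 0 < (C * a)⁻¹ := by positivity
      nlinarith [sq_nonneg ((C * a)⁻¹ - C * a), sq_nonneg ((C * a)⁻¹ + C * a - 2)]
    calc 2 * Real.exp (n * t) ≤ (C⁻¹ * a⁻¹ + C * a) * Real.exp (n * t) := by gcongr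
      _ ≤ (C⁻¹ * Real.exp (2 * n * |u z - t|) + C * a) * Real.exp (n * t) := by gcongr
      _ = _ := by rw [h5]; ring
  have h2 : ENNReal.ofReal (2 * Real.exp (n * t)) * volume B ≤
      ENNReal.ofReal (Real.exp (n * t)) * volume B +
        ENNReal.ofReal C * ∫⁻ z in B, ENNReal.ofReal (Real.exp (n * u z)) := by
    calc _ = ∫⁻ _ in B, ENNReal.ofReal (2 * Real.exp (n * t)) := (setLIntegral_const _ _).symm
      _ ≤ _ := lintegral_mono h1
      _ = ENNReal.ofReal (C⁻¹ * Real.exp (n * t)) *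
            (∫⁻ z in B, ENNReal.ofReal (Real.exp (2 * n * |u z - t|))) +
          ENNReal.ofReal C * ∫⁻ z in B, ENNReal.ofReal (Real.exp (n * u z)) := by
        rw [lintegral_add_right' _ (by fun_prop), lintegral_const_mul' _ _ ENNReal.ofReal_ne_top,
          lintegral_const_mul' _ _ ENNReal.ofReal_ne_top]
      _ ≤ ENNReal.ofReal (C⁻¹ * Real.exp (n * t)) * (ENNReal.ofReal C * volume B) + _ := by
        gcongr
      _ = _ := by
        rw [← mul_assoc, ← ENNReal.ofReal_mul (by positivity), mul_right_comm,
          inv_mul_cancel₀ hC.ne', one_mul]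
  rw [two_mul, ENNReal.ofReal_add (Real.exp_pos _).le (Real.exp_pos _).le, add_mul] at h2
  exact (ENNReal.add_le_add_iff_left (ENNReal.mul_ne_top ENNReal.ofReal_ne_top hB)).1 h2

/-- The reverse Hölder inequality with exponent `2`. -/
lemma rpow_average_exp_le (hu : Measurable u) (hC : 1 ≤ C) (hB : volume B ≠ ⊤)
    (hB0 : volume B ≠ 0)
    (h : ∫⁻ z in B, ENNReal.ofReal (Real.exp (2 * n * |u z - t|)) ≤ ENNReal.ofReal C * volume B) :
    ((volume B)⁻¹ * ∫⁻ z in B, ENNReal.ofReal (Real.exp (n * u z) ^ (1 + 1 : ℝ))) ^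
        (1 / (1 + 1) : ℝ) ≤
      ENNReal.ofReal (C ^ 2) *
        ((volume B)⁻¹ * ∫⁻ z in B, ENNReal.ofReal (Real.exp (n * u z))) := by
  have hC0 : 0 < C := one_pos.trans_le hC
  have h1 := setLIntegral_exp_le h (k := 2 * n) (by positivity) le_rfl
  have h2 := ofReal_exp_mul_volume_le hu hC0 hB h
  have h3 : ENNReal.ofReal (Real.exp (n * t)) ≤ ENNReal.ofReal C *
      ((volume B)⁻¹ * ∫⁻ z in B, ENNReal.ofReal (Real.exp (n * u z))) := by
    rw [mul_left_comm, mul_comm (volume B)⁻¹, ← div_eq_mul_inv]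
    exact (ENNReal.le_div_iff_mul_le (Or.inl hB0) (Or.inl hB)).2 h2
  calc _ ≤ ENNReal.ofReal (C * Real.exp (n * t)) := by
        rw [one_div, ENNReal.rpow_inv_le_iff (by norm_num), mul_comm, ← div_eq_mul_inv]
        refine ENNReal.div_le_of_le_mul ?_
        calc _ = ∫⁻ z in B, ENNReal.ofReal (Real.exp (2 * n * u z)) := by
              refine lintegral_congr fun z => ?_
              rw [← Real.exp_mul]
              ring_nf
          _ ≤ _ := h1
          _ ≤ _ := by
              gcongr
              rw [ENNReal.ofReal_rpow_of_nonneg (by positivity) (by norm_num)]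
              refine ENNReal.ofReal_le_ofReal ?_
              rw [Real.mul_rpow hC0.le (Real.exp_pos _).le, ← Real.exp_mul]
              refine mul_le_mul ?_ (Real.exp_le_exp.2 (le_of_eq (by ring))) (Real.exp_pos _).le
                (by positivity)
              exact Real.self_le_rpow_of_one_le hC (by norm_num)
    _ ≤ _ := by
        rw [ENNReal.ofReal_mul hC0.le, sq, ENNReal.ofReal_mul hC0.le, mul_assoc]
        gcongr

end Averages

variable {E : Type*} [NormedAddCommGroup E] [MeasureSpace E] [BorelSpace E] [NormedSpace ℝ E]
  [FiniteDimensional ℝ E] [Nontrivial E]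
  [(volume : Measure E).IsAddHaarMeasure]

/-- The local means of a potential in the critical range: `u` has uniformly bounded exponential
averages around them, and chains weighted by their exponentials are long. -/
lemma exists_local_means {n : ℕ} (hn : Module.finrank ℝ E = n) {α κ : ℝ}
    (hα : 0 < α) (hαn : α < n) {f : E → ℝ} (hf : Measurable f)
    (hfint : ∫⁻ x, ENNReal.ofReal (|f x| ^ ((n : ℝ) / α)) < ⊤)
    (hconv : ∀ z : E, Integrable fun y => f y * ‖z - y‖ ^ (α - n)) (hκ : 0 ≤ κ) :
    ∃ (T : E → ℝ → ℝ) (C c : ℝ), 1 ≤ C ∧ 0 < c ∧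
      (∀ x R, 0 < R → ∫⁻ z in ball x R, ENNReal.ofReal
        (Real.exp (2 * n * |κ * (∫ y, f y * ‖z - y‖ ^ (α - n)) - T x R|)) ≤
          ENNReal.ofReal C * volume (ball x R)) ∧
      ∀ (s : ℕ → E) (N : ℕ), s 0 ≠ s N →
        c * (‖s 0 - s N‖ * Real.exp (T (s 0) (2 * ‖s 0 - s N‖))) ≤
        ∑ i ∈ Finset.range N, min ‖s i - s (i + 1)‖ ‖s 0 - s N‖ *
          Real.exp (T (s i) (min ‖s i - s (i + 1)‖ ‖s 0 - s N‖)) := by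
  set ω := volume.real (ball (0 : E) 1) with hω
  have hη : 0 < (1 + 4 * n * κ * ω)⁻¹ := by positivity
  have hsmall : 2 * n * κ * ((1 + 4 * n * κ * ω)⁻¹ * (2 * ω)) ≤ 1 := by
    rw [show 2 * n * κ * ((1 + 4 * n * κ * ω)⁻¹ * (2 * ω)) =
      4 * n * κ * ω / (1 + 4 * n * κ * ω) by ring]
    exact (div_le_one (by positivity)).2 (by linarith)
  obtain ⟨h, hh, hF, hconv', M, hM0, hM⟩ := exists_small_potential hn hα hαn hf hfint hconv hη
  obtain ⟨C, hC0, hC⟩ := exists_setLIntegral_exp_truncatedPotential_le hn hα hαn hh hη hF hconv' hκ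
    hsmall
  obtain ⟨c, hc0, hc⟩ := exists_mul_exp_truncatedPotential_le_sum hn hα hαn hh hη hF hconv' hκ
  refine ⟨fun x R => κ * truncatedPotential (α - n) h x R,
    max 1 (Real.exp (2 * n * (κ * M)) * C), c, le_max_left _ _, hc0, fun x R hR => ?_, hc⟩
  calc _ ≤ ∫⁻ z in ball x R, ENNReal.ofReal (Real.exp (2 * n * (κ * M))) *
        ENNReal.ofReal (Real.exp (2 * n * (κ *
          |truncatedPotential (α - n) h z 0 - truncatedPotential (α - n) h x R|))) := by
        refine lintegral_mono fun z => ?_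
        rw [← ENNReal.ofReal_mul (Real.exp_pos _).le, ← Real.exp_add, ← mul_add, ← mul_add]
        refine ENNReal.ofReal_le_ofReal (Real.exp_le_exp.2 ?_)
        refine mul_le_mul_of_nonneg_left ?_ (by positivity)
        rw [← mul_sub, abs_mul, abs_of_nonneg hκ]
        refine mul_le_mul_of_nonneg_left ?_ hκ
        exact (abs_sub_le _ _ _).trans (by gcongr; exact hM z)
    _ ≤ ENNReal.ofReal (Real.exp (2 * n * (κ * M))) * (ENNReal.ofReal C * volume (ball x R)) := by
        rw [lintegral_const_mul' _ _ ENNReal.ofReal_ne_top]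
        gcongr
        exact hC x R hR
    _ ≤ _ := by
        rw [← mul_assoc, ← ENNReal.ofReal_mul (Real.exp_pos _).le]
        gcongr
        exact le_max_right _ _

/-- The `n`-th root of the `e ^ (n * u)`-mass of double balls is comparable to a metric. -/
lemma exists_metric_comparable_to_mass {n : ℕ} (hn : Module.finrank ℝ E = n)
    {u : E → ℝ} (hu : Measurable u) {T : E → ℝ → ℝ} {C c : ℝ} (hC : 1 ≤ C) (hc : 0 < c)
    (hexp : ∀ x R, 0 < R → ∫⁻ z in ball x R, ENNReal.ofReal
      (Real.exp (2 * n * |u z - T x R|)) ≤ ENNReal.ofReal C * volume (ball x R))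
    (hchain : ∀ (s : ℕ → E) (N : ℕ), s 0 ≠ s N →
      c * (‖s 0 - s N‖ * Real.exp (T (s 0) (2 * ‖s 0 - s N‖))) ≤
        ∑ i ∈ Finset.range N, min ‖s i - s (i + 1)‖ ‖s 0 - s N‖ *
          Real.exp (T (s i) (min ‖s i - s (i + 1)‖ ‖s 0 - s N‖))) :
    ∃ d : E → E → ℝ, (∀ x y, 0 ≤ d x y) ∧ (∀ x y, d x y = d y x) ∧ (∀ x y, d x y = 0 ↔ x = y) ∧
      (∀ x y z, d x z ≤ d x y + d y z) ∧ ∃ C₂ ≥ (1 : ℝ), ∀ x y : E,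
        ENNReal.ofReal (C₂⁻¹ * d x y) ≤
          (∫⁻ z in ball x ‖x - y‖ ∪ ball y ‖x - y‖,
            ENNReal.ofReal (Real.exp (n * u z))) ^ ((1 : ℝ) / n) ∧
        (∫⁻ z in ball x ‖x - y‖ ∪ ball y ‖x - y‖,
            ENNReal.ofReal (Real.exp (n * u z))) ^ ((1 : ℝ) / n) ≤ ENNReal.ofReal (C₂ * d x y) := by
  have hn1 : 1 ≤ n := finrank_ne_zero_of_eq hn
  have hn0 : (0 : ℝ) < n := by exact_mod_cast hn1
  have hC0 : 0 < C := one_pos.trans_le hC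
  set ω := volume.real (ball (0 : E) 1) with hω
  have hω0 : 0 < ω := ENNReal.toReal_pos (measure_ball_pos _ _ one_pos).ne' measure_ball_lt_top.ne
  have hvol : ∀ (x : E) {r : ℝ}, 0 ≤ r → volume (ball x r) = ENNReal.ofReal (r ^ n * ω) := by
    intro x r hr
    rw [Measure.addHaar_ball _ x hr, hn, ENNReal.ofReal_mul (by positivity), hω,
      ofReal_measureReal measure_ball_lt_top.ne]
  set m : E → E → ℝ≥0∞ := fun x y => (∫⁻ z in ball x ‖x - y‖ ∪ ball y ‖x - y‖,
    ENNReal.ofReal (Real.exp (n * u z))) ^ ((1 : ℝ) / n) with hm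
  set A := 1 + C * ω with hA
  have hA0 : 0 < A := by positivity
  set b := min 1 (ω / C) with hb
  have hb0 : 0 < b := lt_min one_pos (by positivity)
  have hself : ∀ x, m x x = 0 := by
    intro x
    simp [hm, Nat.lt_of_succ_le hn1]
  have hupper : ∀ x y, m x y ≤
      ENNReal.ofReal (A * (2 * (‖x - y‖ * Real.exp (T x (2 * ‖x - y‖))))) := by
    intro x y
    rcases eq_or_ne x y with rfl | hxy
    · simp [hself]
    have hr : 0 < ‖x - y‖ := norm_pos_iff.2 (sub_ne_zero.2 hxy)
    have hsub : ball x ‖x - y‖ ∪ ball y ‖x - y‖ ⊆ ball x (2 * ‖x - y‖) :=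
      union_subset (ball_subset_ball (by linarith))
        (ball_subset_ball' (by rw [dist_comm, dist_eq_norm]; linarith))
    rw [hm]
    dsimp only
    rw [one_div, ENNReal.rpow_inv_le_iff hn0, ENNReal.rpow_natCast,
      ← ENNReal.ofReal_pow (by positivity)]
    calc _ ≤ _ := lintegral_mono_set hsub
      _ ≤ _ := setLIntegral_exp_le (hexp x _ (by positivity)) hn0.le (by linarith)
      _ = ENNReal.ofReal (C * ω * (2 * (‖x - y‖ * Real.exp (T x (2 * ‖x - y‖)))) ^ n) := by
        rw [hvol x (by positivity), ← ENNReal.ofReal_mul (by positivity), Real.exp_nat_mul]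
        ring_nf
      _ ≤ _ := by
        refine ENNReal.ofReal_le_ofReal ?_
        rw [mul_pow A]
        gcongr
        exact (by linarith : C * ω ≤ A).trans (le_self_pow₀ (by linarith [mul_pos hC0 hω0])
          (by omega))
  have hlower : ∀ x y (ρ : ℝ), 0 ≤ ρ → ρ ≤ ‖x - y‖ →
      ENNReal.ofReal (b * (ρ * Real.exp (T x ρ))) ≤ m x y := by
    intro x y ρ hρ0 hρ
    rcases hρ0.eq_or_lt with rfl | hρ0
    · simp
    rw [hm]
    dsimp only
    rw [one_div, ENNReal.le_rpow_inv_iff hn0, ENNReal.rpow_natCast,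
      ← ENNReal.ofReal_pow (by positivity)]
    have h1 := ofReal_exp_mul_volume_le hu hC0 measure_ball_lt_top.ne (hexp x ρ hρ0)
    rw [hvol x hρ0.le, ← ENNReal.ofReal_mul (Real.exp_pos _).le] at h1
    calc _ ≤ ENNReal.ofReal (C⁻¹ * (Real.exp (n * T x ρ) * (ρ ^ n * ω))) := by
          refine ENNReal.ofReal_le_ofReal ?_
          rw [mul_pow, mul_pow, Real.exp_nat_mul]
          have hbn : b ^ n ≤ ω / C := (pow_le_of_le_one hb0.le (min_le_left _ _) (by omega)).trans
            (min_le_right _ _)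
          calc _ ≤ ω / C * (ρ ^ n * Real.exp (T x ρ) ^ n) := by gcongr
            _ = _ := by ring
      _ ≤ ∫⁻ z in ball x ρ, ENNReal.ofReal (Real.exp (n * u z)) := by
          rw [ENNReal.ofReal_mul (by positivity), ENNReal.ofReal_inv_of_pos hC0]
          refine (mul_le_mul_right h1 _).trans ?_
          rw [← mul_assoc, ENNReal.inv_mul_cancel (by simpa using hC0) ENNReal.ofReal_ne_top,
            one_mul]
      _ ≤ _ := lintegral_mono_set ((ball_subset_ball hρ).trans subset_union_left)
  have hmtop : ∀ x y, m x y ≠ ⊤ := fun x y => ne_top_of_le_ne_top ENNReal.ofReal_ne_top (hupper x y)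
  have hqm : ∀ x y, ENNReal.ofReal ((m x y).toNNReal : ℝ) = m x y := fun x y => by
    rw [ENNReal.ofReal_coe_nnreal, ENNReal.coe_toNNReal (hmtop x y)]
  have hpos : ∀ x y, (m x y).toNNReal = 0 → x = y := by
    intro x y hxy
    by_contra hne
    have hr : 0 < ‖x - y‖ := norm_pos_iff.2 (sub_ne_zero.2 hne)
    have h1 := hlower x y _ hr.le le_rfl
    rw [← hqm x y, hxy, NNReal.coe_zero, ENNReal.ofReal_zero, nonpos_iff_eq_zero,
      ENNReal.ofReal_eq_zero] at h1
    exact h1.not_gt (by positivity)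
  have hchain' : ∀ (s : ℕ → E) (N : ℕ), s 0 ≠ s N → b * c / (2 * A) * (m (s 0) (s N)).toNNReal ≤
      ∑ i ∈ Finset.range N, ((m (s i) (s (i + 1))).toNNReal : ℝ) := by
    intro s N hne
    have hup : ((m (s 0) (s N)).toNNReal : ℝ) ≤
        A * (2 * (‖s 0 - s N‖ * Real.exp (T (s 0) (2 * ‖s 0 - s N‖)))) := by
      have := hupper (s 0) (s N)
      rwa [← hqm, ENNReal.ofReal_le_ofReal_iff (by positivity)] at this
    have hlow : ∀ i, b * (min ‖s i - s (i + 1)‖ ‖s 0 - s N‖ *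
          Real.exp (T (s i) (min ‖s i - s (i + 1)‖ ‖s 0 - s N‖))) ≤
        ((m (s i) (s (i + 1))).toNNReal : ℝ) := by
      intro i
      have := hlower (s i) (s (i + 1)) (min ‖s i - s (i + 1)‖ ‖s 0 - s N‖) (by positivity)
        (min_le_left _ _)
      rwa [← hqm, ENNReal.ofReal_le_ofReal_iff (NNReal.coe_nonneg _)] at this
    calc _ ≤ b * c / (2 * A) *
          (A * (2 * (‖s 0 - s N‖ * Real.exp (T (s 0) (2 * ‖s 0 - s N‖))))) := by gcongr
      _ = b * (c * (‖s 0 - s N‖ * Real.exp (T (s 0) (2 * ‖s 0 - s N‖)))) := by field_simp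
      _ ≤ _ := mul_le_mul_of_nonneg_left (hchain s N hne) hb0.le
      _ ≤ _ := by
        rw [Finset.mul_sum]
        exact Finset.sum_le_sum fun i _ => hlow i
  obtain ⟨d, hd0, hdcomm, hdeq, hdtri, hd⟩ := exists_comparable_metric
    (q := fun x y => (m x y).toNNReal) (c := b * c / (2 * A)) (fun x => by simp [hself])
    (fun x y => by simp only [hm, norm_sub_rev x y, union_comm]) hpos (by positivity) hchain'
  set c' := b * c / (2 * A) with hc'
  have hc'0 : 0 < c' := by positivity
  refine ⟨d, hd0, hdcomm, hdeq, hdtri, max 1 c'⁻¹, le_max_left _ _, fun x y => ?_⟩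
  have hq := hqm x y
  obtain ⟨h1, h2⟩ := hd x y
  refine ⟨?_, ?_⟩
  · change _ ≤ m x y
    rw [← hq]
    refine ENNReal.ofReal_le_ofReal (le_trans ?_ h2)
    exact mul_le_of_le_one_left (hd0 x y) (inv_le_one_of_one_le₀ (le_max_left _ _))
  · change m x y ≤ _
    rw [← hq]
    refine ENNReal.ofReal_le_ofReal ?_
    calc _ = c'⁻¹ * (c' * ((m x y).toNNReal : ℝ)) := by field_simp
      _ ≤ max 1 c'⁻¹ * d x y := by gcongr; exact le_max_right _ _

end Weights

/-- (Bonk–Heinonen–Saksman) Let `n ≥ 2`, `α ∈ (0,n)`, and let `f : ℝⁿ → ℝ`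
be measurable with `∫ |f|^{n/α} dH^n < ∞`. If the Riesz potential
`u(x) = (Γ((n-α)/2)/(2^α π^{n/2} Γ(α/2))) ∫ f(y) |x-y|^{α-n} dH^n(y)` converges absolutely
at every `x`, then `w = e^{nu}` is a strong `A_∞`-weight: (a) it satisfies a reverse
Hölder (A_∞) condition on all Euclidean balls, and (b) the `n`-th root of the `w`-mass of
the double ball `B_{|x-y|}(x) ∪ B_{|x-y|}(y)` is comparable to a metric `d` on `ℝⁿ`. -/
theorem stmt_9 (n : ℕ) (hn : 2 ≤ n) (α : ℝ) (hα0 : 0 < α) (hαn : α < n)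
    (f : EuclideanSpace ℝ (Fin n) → ℝ) (hfm : Measurable f)
    (hfint : ∫⁻ x, ENNReal.ofReal (|f x| ^ ((n:ℝ)/α)) < ⊤)
    (hconv : ∀ x : EuclideanSpace ℝ (Fin n),
      Integrable (fun y : EuclideanSpace ℝ (Fin n) => f y * ‖x - y‖ ^ (α - n)) volume)
    (u : EuclideanSpace ℝ (Fin n) → ℝ)
    (hu : ∀ x, u x =
      (Real.Gamma (((n:ℝ) - α)/2) / (2 ^ α * Real.pi ^ ((n:ℝ)/2) * Real.Gamma (α/2))) *
        ∫ y : EuclideanSpace ℝ (Fin n), f y * ‖x - y‖ ^ (α - n))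
    (w : EuclideanSpace ℝ (Fin n) → ℝ)
    (hwdef : ∀ x, w x = Real.exp ((n : ℝ) * u x)) :
    (∃ ε > (0:ℝ), ∃ C₁ ≥ (1:ℝ), ∀ (x : EuclideanSpace ℝ (Fin n)) (r : ℝ), 0 < r →
      ((volume (ball x r))⁻¹ *
          ∫⁻ z in ball x r, ENNReal.ofReal (w z ^ (1 + ε))) ^ (1/(1 + ε)) ≤
        ENNReal.ofReal C₁ *
          ((volume (ball x r))⁻¹ * ∫⁻ z in ball x r, ENNReal.ofReal (w z))) ∧
    (∃ d : EuclideanSpace ℝ (Fin n) → EuclideanSpace ℝ (Fin n) → ℝ,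
      (∀ x y, 0 ≤ d x y) ∧ (∀ x y, d x y = d y x) ∧
      (∀ x y, d x y = 0 ↔ x = y) ∧ (∀ x y z, d x z ≤ d x y + d y z) ∧
      ∃ C₂ ≥ (1:ℝ), ∀ x y : EuclideanSpace ℝ (Fin n),
        ENNReal.ofReal (C₂⁻¹ * d x y) ≤
          (∫⁻ z in ball x ‖x - y‖ ∪ ball y ‖x - y‖, ENNReal.ofReal (w z)) ^ ((1:ℝ)/n) ∧
        (∫⁻ z in ball x ‖x - y‖ ∪ ball y ‖x - y‖, ENNReal.ofReal (w z)) ^ ((1:ℝ)/n) ≤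
          ENNReal.ofReal (C₂ * d x y)) := by
  obtain rfl : w = fun x => Real.exp (n * u x) := funext hwdef
  have : NeZero n := ⟨by omega⟩
  have hfin : Module.finrank ℝ (EuclideanSpace ℝ (Fin n)) = n := finrank_euclideanSpace_fin
  have hκ : 0 ≤ Real.Gamma (((n:ℝ) - α)/2) /
      (2 ^ α * Real.pi ^ ((n:ℝ)/2) * Real.Gamma (α/2)) := by
    have h1 := Real.Gamma_pos_of_pos (half_pos (sub_pos.2 hαn))
    have h2 := Real.Gamma_pos_of_pos (half_pos hα0)
    positivity
  have hum : Measurable u := by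
    rw [funext hu]
    refine measurable_const.mul (StronglyMeasurable.integral_prod_right ?_).measurable
    exact Measurable.stronglyMeasurable (by fun_prop)
  obtain ⟨T, C, c, hC, hc, hexp, hchain⟩ := exists_local_means hfin hα0 hαn hfm hfint hconv hκ
  simp only [← hu] at hexp
  refine ⟨⟨1, one_pos, C ^ 2, one_le_pow₀ hC, fun x r hr => ?_⟩,
    exists_metric_comparable_to_mass hfin hum hC hc hexp hchain⟩
  exact rpow_average_exp_le hum hC measure_ball_lt_top.ne (measure_ball_pos _ x hr).ne'
    (hexp x r hr)
end
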